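/- arXiv:math/0611358 — 5 statements merged into one kernel-verified Lean document; each statement's English description precedes it below -/
import Mathlib

section
/- An R-module M is strongly Gorenstein projective if and only if there exists a short exact sequence of R-modules 0 → M → P → M → 0 with P projective, and Ext^i_R(M,Q) = 0 for some integer i > 0 and every projective R-module Q. -/
/-! Definitions for Gorenstein homological algebra over an arbitrary
associative ring `R` (left modules; right modules are `Rᵐᵒᵖ`-modules). -/

universe u

section Defs

variable (R : Type u) [Ring R]

/-- `0 → A → B → C → 0` is a short exact sequence. -/
def IsSES {A B C : Type u} [AddCommGroup A] [Module R A] [AddCommGroup B] [Module R B]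
    [AddCommGroup C] [Module R C] (f : A →ₗ[R] B) (g : B →ₗ[R] C) : Prop :=
  Function.Injective f ∧ Function.Exact f g ∧ Function.Surjective g

/-- `M` is Gorenstein projective: it is the kernel of a map in a doubly infinite exact
complex of projective modules which stays exact under `Hom_R(-, Q)` for every projective `Q`. -/
def GorensteinProjective (M : Type u) [AddCommGroup M] [Module R M] : Prop :=
  ∃ (P : ℤ → Type u) (_ : ∀ i, AddCommGroup (P i)) (_ : ∀ i, Module R (P i))
    (d : ∀ i, P i →ₗ[R] P (i + 1)),
      (∀ i, Module.Projective R (P i)) ∧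
      (∀ i, Function.Exact (d i) (d (i + 1))) ∧
      Nonempty (M ≃ₗ[R] LinearMap.ker (d 0)) ∧
      (∀ (Q : Type u) (_ : AddCommGroup Q) (_ : Module R Q), Module.Projective R Q →
        ∀ i, Function.Exact (fun g : P (i + 1 + 1) →ₗ[R] Q => g.comp (d (i + 1)))
          (fun g : P (i + 1) →ₗ[R] Q => g.comp (d i)))

/-- `M` is strongly Gorenstein projective: there is a complete projective resolution
with a single projective module `P` and a single map `f`. -/
def StronglyGorensteinProjective (M : Type u) [AddCommGroup M] [Module R M] : Prop :=
  ∃ (P : Type u) (_ : AddCommGroup P) (_ : Module R P) (f : P →ₗ[R] P),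
    Module.Projective R P ∧
    Function.Exact f f ∧
    Nonempty (M ≃ₗ[R] LinearMap.ker f) ∧
    (∀ (Q : Type u) (_ : AddCommGroup Q) (_ : Module R Q), Module.Projective R Q →
      Function.Exact (fun g : P →ₗ[R] Q => g.comp f) (fun g : P →ₗ[R] Q => g.comp f))

/-- `M` is Gorenstein injective (dual to Gorenstein projective). -/
def GorensteinInjective (M : Type u) [AddCommGroup M] [Module R M] : Prop :=
  ∃ (I : ℤ → Type u) (_ : ∀ i, AddCommGroup (I i)) (_ : ∀ i, Module R (I i))
    (d : ∀ i, I i →ₗ[R] I (i + 1)),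
      (∀ i, Module.Injective R (I i)) ∧
      (∀ i, Function.Exact (d i) (d (i + 1))) ∧
      Nonempty (M ≃ₗ[R] LinearMap.ker (d 0)) ∧
      (∀ (E : Type u) (_ : AddCommGroup E) (_ : Module R E), Module.Injective R E →
        ∀ i, Function.Exact (fun g : E →ₗ[R] I i => (d i).comp g)
          (fun g : E →ₗ[R] I (i + 1) => (d (i + 1)).comp g))

/-- `M` is strongly Gorenstein injective. -/
def StronglyGorensteinInjective (M : Type u) [AddCommGroup M] [Module R M] : Prop :=
  ∃ (I : Type u) (_ : AddCommGroup I) (_ : Module R I) (f : I →ₗ[R] I),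
    Module.Injective R I ∧
    Function.Exact f f ∧
    Nonempty (M ≃ₗ[R] LinearMap.ker f) ∧
    (∀ (E : Type u) (_ : AddCommGroup E) (_ : Module R E), Module.Injective R E →
      Function.Exact (fun g : E →ₗ[R] I => f.comp g) (fun g : E →ₗ[R] I => f.comp g))

/-- `M` admits a resolution `0 → G_n → ⋯ → G_0 → M → 0` by modules satisfying `𝒢`
(formalized as an `ℕ`-indexed resolution vanishing in degrees `> n`). -/
def HasLeftResolutionLE
    (𝒢 : ∀ (N : Type u) [AddCommGroup N] [Module R N], Prop)
    (M : Type u) [AddCommGroup M] [Module R M] (n : ℕ) : Prop :=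
  ∃ (G : ℕ → Type u) (_ : ∀ i, AddCommGroup (G i)) (_ : ∀ i, Module R (G i))
    (d : ∀ i, G (i + 1) →ₗ[R] G i) (π : G 0 →ₗ[R] M),
      (∀ i, 𝒢 (G i)) ∧
      (∀ i, n < i → Subsingleton (G i)) ∧
      Function.Surjective π ∧ Function.Exact (d 0) π ∧
      (∀ i, Function.Exact (d (i + 1)) (d i))

/-- `M` admits a coresolution `0 → M → G^0 → ⋯ → G^n → 0` by modules satisfying `𝒢`. -/
def HasRightResolutionLE
    (𝒢 : ∀ (N : Type u) [AddCommGroup N] [Module R N], Prop)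
    (M : Type u) [AddCommGroup M] [Module R M] (n : ℕ) : Prop :=
  ∃ (G : ℕ → Type u) (_ : ∀ i, AddCommGroup (G i)) (_ : ∀ i, Module R (G i))
    (d : ∀ i, G i →ₗ[R] G (i + 1)) (ι : M →ₗ[R] G 0),
      (∀ i, 𝒢 (G i)) ∧
      (∀ i, n < i → Subsingleton (G i)) ∧
      Function.Injective ι ∧ Function.Exact ι (d 0) ∧
      (∀ i, Function.Exact (d i) (d (i + 1)))

variable (M : Type u) [AddCommGroup M] [Module R M]

/-- Projective dimension, valued in `ℕ∞`. -/
noncomputable def pDim : ℕ∞ :=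
  sInf ((↑) '' {n : ℕ | HasLeftResolutionLE R (fun N _ _ => Module.Projective R N) M n})

/-- Injective dimension, valued in `ℕ∞`. -/
noncomputable def iDim : ℕ∞ :=
  sInf ((↑) '' {n : ℕ | HasRightResolutionLE R (fun N _ _ => Module.Injective R N) M n})

/-- Gorenstein projective dimension, valued in `ℕ∞`. -/
noncomputable def gpDim : ℕ∞ :=
  sInf ((↑) '' {n : ℕ | HasLeftResolutionLE R (fun N _ _ => GorensteinProjective R N) M n})

/-- Gorenstein injective dimension, valued in `ℕ∞`. -/
noncomputable def giDim : ℕ∞ :=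
  sInf ((↑) '' {n : ℕ | HasRightResolutionLE R (fun N _ _ => GorensteinInjective R N) M n})

/-- The left global dimension of `R`. -/
noncomputable def gldim : ℕ∞ :=
  sSup {d : ℕ∞ | ∃ (M : Type u) (_ : AddCommGroup M) (_ : Module R M), d = pDim R M}

/-- The left finitistic projective dimension of `R`. -/
noncomputable def FPD : ℕ∞ :=
  sSup {d : ℕ∞ | ∃ (M : Type u) (_ : AddCommGroup M) (_ : Module R M),
    pDim R M ≠ ⊤ ∧ d = pDim R M}

/-- The left Gorenstein global dimension of `R`: `sup { Gpd_R(M) }`. -/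
noncomputable def GPgldim : ℕ∞ :=
  sSup {d : ℕ∞ | ∃ (M : Type u) (_ : AddCommGroup M) (_ : Module R M), d = gpDim R M}

/-- `sup { Gid_R(M) }` over all left `R`-modules `M`. -/
noncomputable def GIgldim : ℕ∞ :=
  sSup {d : ℕ∞ | ∃ (M : Type u) (_ : AddCommGroup M) (_ : Module R M), d = giDim R M}

end Defs
section ExtDef

open CategoryTheory

/-- `Ext^i_R(M, Q) = 0` (vanishing of the `i`-th Ext group of left `R`-modules). -/
def extVanish (R : Type u) [Ring R] (M Q : Type u) [AddCommGroup M] [Module R M]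
    [AddCommGroup Q] [Module R Q] (i : ℕ) : Prop :=
  letI := HasDerivedCategory.standard (ModuleCat.{u} R)
  letI := hasExt_of_hasDerivedCategory (ModuleCat.{u} R)
  Subsingleton (CategoryTheory.Abelian.Ext (ModuleCat.of R M) (ModuleCat.of R Q) i)

end ExtDef
section Helpers

open CategoryTheory CategoryTheory.Abelian

universe w

/-- The short exact sequence in the category of modules attached to an `IsSES`. -/
theorem exists_shortExact_of_isSES {R : Type u} [Ring R] {A B C : Type u}
    [AddCommGroup A] [Module R A] [AddCommGroup B] [Module R B]
    [AddCommGroup C] [Module R C] {f : A →ₗ[R] B} {g : B →ₗ[R] C} (h : IsSES R f g) :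
    ∃ hz, (ShortComplex.mk (ModuleCat.ofHom f) (ModuleCat.ofHom g) hz).ShortExact := by
  obtain ⟨h1, h2, h3⟩ := h
  refine ⟨ModuleCat.hom_ext h2.linearMap_comp_eq_zero, ?_⟩
  exact
    { exact := (ShortComplex.ShortExact.moduleCat_exact_iff_function_exact _).2 h2
      mono_f := (ModuleCat.mono_iff_injective _).2 h1
      epi_g := (ModuleCat.epi_iff_surjective _).2 h3 }

theorem ext_step_down {R : Type u} [Ring R] [HasExt.{w} (ModuleCat.{u} R)]
    {M P Q : Type u} [AddCommGroup M] [Module R M] [AddCommGroup P] [Module R P]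
    [AddCommGroup Q] [Module R Q] [Module.Projective R P]
    {α : M →ₗ[R] P} {β : P →ₗ[R] M} (h : IsSES R α β) (n : ℕ)
    (hs : Subsingleton (Ext.{w} (ModuleCat.of R M) (ModuleCat.of R Q) (n + 2))) :
    Subsingleton (Ext.{w} (ModuleCat.of R M) (ModuleCat.of R Q) (n + 1)) := by
  obtain ⟨hz, hS⟩ := exists_shortExact_of_isSES h
  have : Projective (ModuleCat.of R P) := (IsProjective.iff_projective P).1 inferInstance
  refine subsingleton_of_forall_eq 0 fun x => ?_
  obtain ⟨y, hy⟩ := Ext.contravariant_sequence_exact₁ hS (ModuleCat.of R Q) x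
    (n₁ := n + 2) (by omega) (hs.elim _ _)
  rw [← hy, show y = 0 from Ext.eq_zero_of_projective (P := ModuleCat.of R P) y, Ext.comp_zero]

theorem ext_one_iff {R : Type u} [Ring R] [HasExt.{w} (ModuleCat.{u} R)]
    {M P Q : Type u} [AddCommGroup M] [Module R M] [AddCommGroup P] [Module R P]
    [AddCommGroup Q] [Module R Q] [Module.Projective R P]
    {α : M →ₗ[R] P} {β : P →ₗ[R] M} (h : IsSES R α β) :
    Subsingleton (Ext.{w} (ModuleCat.of R M) (ModuleCat.of R Q) 1) ↔
      ∀ k : M →ₗ[R] Q, ∃ g : P →ₗ[R] Q, g.comp α = k := by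
  obtain ⟨hz, hS⟩ := exists_shortExact_of_isSES h
  have : Projective (ModuleCat.of R P) := (IsProjective.iff_projective P).1 inferInstance
  constructor
  · intro hs k
    obtain ⟨y, hy⟩ := Ext.contravariant_sequence_exact₁ hS (ModuleCat.of R Q)
      (Ext.mk₀ (ModuleCat.ofHom k)) (n₁ := 1) rfl (hs.elim _ _)
    obtain ⟨g, rfl⟩ := Ext.homEquiv₀.symm.surjective y
    refine ⟨g.hom, ?_⟩
    rw [Ext.homEquiv₀_symm_apply, Ext.mk₀_comp_mk₀] at hy
    have := Ext.homEquiv₀.symm.injective hy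
    exact congrArg ModuleCat.Hom.hom this
  · intro hk
    refine subsingleton_of_forall_eq 0 fun x => ?_
    obtain ⟨y, hy⟩ := Ext.contravariant_sequence_exact₃ hS (ModuleCat.of R Q) x
      (Ext.eq_zero_of_projective (P := ModuleCat.of R P) (n := 0) _) (n₀ := 0) rfl
    obtain ⟨k, rfl⟩ := Ext.homEquiv₀.symm.surjective y
    obtain ⟨g, hg⟩ := hk k.hom
    have hk' : k = ModuleCat.ofHom α ≫ ModuleCat.ofHom g := ModuleCat.hom_ext hg.symm
    rw [← hy, Ext.homEquiv₀_symm_apply, hk', ← Ext.mk₀_comp_mk₀]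
    exact hS.extClass_comp_assoc _

theorem extVanish_step_down {R : Type u} [Ring R]
    {M P Q : Type u} [AddCommGroup M] [Module R M] [AddCommGroup P] [Module R P]
    [AddCommGroup Q] [Module R Q] (hP : Module.Projective R P)
    {α : M →ₗ[R] P} {β : P →ₗ[R] M} (h : IsSES R α β) (n : ℕ)
    (hs : extVanish R M Q (n + 2)) : extVanish R M Q (n + 1) := by
  letI := HasDerivedCategory.standard (ModuleCat.{u} R)
  letI i := hasExt_of_hasDerivedCategory (ModuleCat.{u} R)
  exact @ext_step_down R _ i M P Q _ _ _ _ _ _ hP α β h n hs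

theorem extVanish_one_iff {R : Type u} [Ring R]
    {M P Q : Type u} [AddCommGroup M] [Module R M] [AddCommGroup P] [Module R P]
    [AddCommGroup Q] [Module R Q] (hP : Module.Projective R P)
    {α : M →ₗ[R] P} {β : P →ₗ[R] M} (h : IsSES R α β) :
    extVanish R M Q 1 ↔ ∀ k : M →ₗ[R] Q, ∃ g : P →ₗ[R] Q, g.comp α = k := by
  letI := HasDerivedCategory.standard (ModuleCat.{u} R)
  letI i := hasExt_of_hasDerivedCategory (ModuleCat.{u} R)
  exact @ext_one_iff R _ i M P Q _ _ _ _ _ _ hP α β h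

end Helpers

/-- A module `M` is strongly Gorenstein projective if and only if there exists a short
exact sequence `0 → M → P → M → 0` with `P` projective, and `Ext^i_R(M, Q) = 0` for some
integer `i > 0` and every projective `R`-module `Q`. -/
theorem strongly_gorenstein_projective_iff (R : Type u) [Ring R]
    (M : Type u) [AddCommGroup M] [Module R M] :
    StronglyGorensteinProjective R M ↔
      ((∃ (P : Type u) (_ : AddCommGroup P) (_ : Module R P)
          (α : M →ₗ[R] P) (β : P →ₗ[R] M), Module.Projective R P ∧ IsSES R α β) ∧
        ∃ i : ℕ, 0 < i ∧ ∀ (Q : Type u) (_ : AddCommGroup Q) (_ : Module R Q),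
          Module.Projective R Q → extVanish R M Q i) := by
  constructor
  · rintro ⟨P, _, _, f, hP, hf, ⟨e⟩, hQ⟩
    have hff : ∀ x, f (f x) = 0 := fun x => (hf (f x)).2 ⟨x, rfl⟩
    let α : M →ₗ[R] P := (LinearMap.ker f).subtype.comp e.toLinearMap
    let β : P →ₗ[R] M := e.symm.toLinearMap.comp (f.codRestrict (LinearMap.ker f) hff)
    have hαβ : ∀ x, α (β x) = f x := fun x => by
      simp only [α, β, LinearMap.comp_apply, LinearEquiv.coe_coe, LinearEquiv.apply_symm_apply]
      rfl
    have hα : Function.Injective α :=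
      (Submodule.injective_subtype _).comp e.injective
    have hses : IsSES R α β := by
      refine ⟨hα, fun x => ?_, fun m => ?_⟩
      · have h0 : β x = 0 ↔ f x = 0 := by
          rw [← hαβ, map_eq_zero_iff α hα]
        rw [h0]
        constructor
        · intro hx
          exact ⟨e.symm ⟨x, hx⟩, by simp [α]⟩
        · rintro ⟨m, rfl⟩
          exact (e m).2
      · obtain ⟨x, hx⟩ := (hf (α m)).1 (e m).2
        exact ⟨x, hα (by rw [hαβ, hx])⟩
    refine ⟨⟨P, _, _, α, β, hP, hses⟩, 1, one_pos, fun Q _ _ hq => ?_⟩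
    refine (extVanish_one_iff (Q := Q) hP hses).2 fun k => ?_
    obtain ⟨g, hg⟩ := (hQ Q _ _ hq (k.comp β)).1 (by
      ext x
      have : β (f x) = 0 := hα (by rw [hαβ, hff, map_zero])
      simp [this])
    refine ⟨g, ?_⟩
    ext m
    obtain ⟨x, rfl⟩ := hses.2.2 m
    have := LinearMap.congr_fun hg x
    simpa [hαβ] using this
  · rintro ⟨⟨P, _, _, α, β, hP, hses⟩, i, hi, hext⟩
    obtain ⟨n, rfl⟩ : ∃ n, i = n + 1 := ⟨i - 1, by omega⟩
    have hone : ∀ (Q : Type u) (_ : AddCommGroup Q) (_ : Module R Q),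
        Module.Projective R Q → extVanish R M Q 1 := by
      clear hi
      induction n with
      | zero => exact hext
      | succ n ih =>
        exact ih fun Q _ _ hq =>
          extVanish_step_down hP hses n (hext Q _ _ hq)
    obtain ⟨hα, hex, hβ⟩ := id hses
    have hβα : ∀ m, β (α m) = 0 := fun m => (hex _).2 ⟨m, rfl⟩
    have hker : ∀ x, α (β x) = 0 ↔ β x = 0 := fun x => map_eq_zero_iff α hα
    refine ⟨P, _, _, α.comp β, hP, fun x => ?_, ⟨?_⟩, fun Q _ _ hq h => ?_⟩
    · simp only [LinearMap.comp_apply, hker, Set.mem_range]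
      rw [hex x]
      constructor
      · rintro ⟨m, rfl⟩
        obtain ⟨y, rfl⟩ := hβ m
        exact ⟨y, rfl⟩
      · rintro ⟨y, rfl⟩
        exact ⟨β y, rfl⟩
    · refine (LinearEquiv.ofInjective α hα).trans (LinearEquiv.ofEq _ _ ?_)
      ext x
      simp only [LinearMap.mem_ker, LinearMap.comp_apply, hker]
      exact (hex x).symm
    · constructor
      · intro hh
        have hh' : ∀ m, h (α m) = 0 := fun m => by
          obtain ⟨y, rfl⟩ := hβ m
          exact LinearMap.congr_fun hh y
        have hle : LinearMap.ker β ≤ LinearMap.ker h := fun x hx => by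
          obtain ⟨m, rfl⟩ := (hex x).1 hx
          exact hh' m
        let k : M →ₗ[R] Q := ((LinearMap.ker β).liftQ h hle).comp
          (β.quotKerEquivOfSurjective hβ).symm.toLinearMap
        have hk : ∀ x, k (β x) = h x := fun x => by
          have : (β.quotKerEquivOfSurjective hβ).symm (β x) = (LinearMap.ker β).mkQ x := by
            rw [LinearEquiv.symm_apply_eq]
            rfl
          simp [k, this]
        obtain ⟨g, hg⟩ :=
          (extVanish_one_iff (Q := Q) hP hses).1 (hone Q _ _ hq) k
        refine ⟨g, ?_⟩
        ext x
        rw [← hk x, ← hg]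
        rfl
      · rintro ⟨g, rfl⟩
        ext x
        simp [hβα]
end

section
/- An R-module M is strongly Gorenstein injective if and only if there exists a short exact sequence of R-modules 0 → M → I → M → 0 with I injective, and Ext^i_R(E,M) = 0 for some integer i > 0 and every injective R-module E. -/
/-! Definitions for Gorenstein homological algebra over an arbitrary
associative ring `R` (left modules; right modules are `Rᵐᵒᵖ`-modules). -/

universe u

section Helpers

open CategoryTheory Abelian

universe w

variable {R : Type u} [Ring R] {M I : Type u} [AddCommGroup M] [Module R M]
  [AddCommGroup I] [Module R I]

lemma sgi_shift [HasExt.{w} (ModuleCat.{u} R)] {α : M →ₗ[R] I} {β : I →ₗ[R] M}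
    (hI : Module.Injective R I) (h : IsSES R α β) (X : ModuleCat.{u} R) (n : ℕ)
    (hn : Subsingleton (Ext X (ModuleCat.of R M) (n + 2))) :
    Subsingleton (Ext X (ModuleCat.of R M) (n + 1)) := by
  have hI' : Injective (ModuleCat.of R I) := Module.injective_object_of_injective_module R I
  let S : ShortComplex (ModuleCat.{u} R) :=
    ShortComplex.mk (ModuleCat.ofHom α) (ModuleCat.ofHom β)
      (by ext x; exact h.2.1.apply_apply_eq_zero x)
  have hS : S.ShortExact := ModuleCat.shortComplex_shortExact S h.2.1 h.1 h.2.2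
  refine subsingleton_of_forall_eq 0 fun x => ?_
  obtain ⟨y, hy⟩ := Ext.covariant_sequence_exact₃ X hS (n₀ := n + 1) (n₁ := n + 2) x rfl
    (hn.elim _ _)
  have : y = 0 := Ext.eq_zero_of_injective (I := ModuleCat.of R I) y
  rw [← hy, this, Ext.zero_comp]

lemma sgi_one [HasExt.{w} (ModuleCat.{u} R)] {α : M →ₗ[R] I} {β : I →ₗ[R] M}
    (hI : Module.Injective R I) (h : IsSES R α β) (E : Type u) [AddCommGroup E] [Module R E] :
    Subsingleton (Ext (ModuleCat.of R E) (ModuleCat.of R M) 1) ↔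
      ∀ g : E →ₗ[R] M, ∃ k : E →ₗ[R] I, β.comp k = g := by
  have hI' : Injective (ModuleCat.of R I) := Module.injective_object_of_injective_module R I
  let S : ShortComplex (ModuleCat.{u} R) :=
    ShortComplex.mk (ModuleCat.ofHom α) (ModuleCat.ofHom β)
      (by ext x; exact h.2.1.apply_apply_eq_zero x)
  have hS : S.ShortExact := ModuleCat.shortComplex_shortExact S h.2.1 h.1 h.2.2
  constructor
  · intro hn g
    obtain ⟨y, hy⟩ := Ext.covariant_sequence_exact₃ (ModuleCat.of R E) hS (n₀ := 0) (n₁ := 1)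
      (Ext.mk₀ (ModuleCat.ofHom g)) rfl (hn.elim _ _)
    obtain ⟨k, rfl⟩ := (Ext.mk₀_bijective _ _).2 y
    rw [Ext.mk₀_comp_mk₀] at hy
    have hk := (Ext.mk₀_bijective _ _).1 hy
    exact ⟨k.hom, congrArg ModuleCat.Hom.hom hk⟩
  · intro hl
    refine subsingleton_of_forall_eq 0 fun x => ?_
    obtain ⟨z, hz⟩ := Ext.covariant_sequence_exact₁ (ModuleCat.of R E) hS (n₁ := 1) x
      (Ext.eq_zero_of_injective (I := ModuleCat.of R I) (n := 0) _) (n₀ := 0) rfl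
    obtain ⟨g, rfl⟩ := (Ext.mk₀_bijective _ _).2 z
    obtain ⟨k, hk⟩ := hl g.hom
    have hg : g = ModuleCat.ofHom k ≫ S.g := by
      ext x
      exact (LinearMap.congr_fun hk x).symm
    rw [← hz, hg, ← Ext.mk₀_comp_mk₀, Ext.comp_assoc_of_second_deg_zero,
      ShortComplex.ShortExact.comp_extClass, Ext.comp_zero]

lemma sgi_down [HasExt.{w} (ModuleCat.{u} R)] {α : M →ₗ[R] I} {β : I →ₗ[R] M}
    (hI : Module.Injective R I) (h : IsSES R α β) (X : ModuleCat.{u} R) (n : ℕ)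
    (hn : Subsingleton (Ext X (ModuleCat.of R M) (n + 1))) :
    Subsingleton (Ext X (ModuleCat.of R M) 1) := by
  induction n with
  | zero => exact hn
  | succ n ih => exact ih (sgi_shift hI h X n hn)

end Helpers

/-- A module `M` is strongly Gorenstein injective if and only if there exists a short
exact sequence `0 → M → I → M → 0` with `I` injective, and `Ext^i_R(E, M) = 0` for some
integer `i > 0` and every injective `R`-module `E`. -/
theorem strongly_gorenstein_injective_iff (R : Type u) [Ring R]
    (M : Type u) [AddCommGroup M] [Module R M] :
    StronglyGorensteinInjective R M ↔
      ((∃ (I : Type u) (_ : AddCommGroup I) (_ : Module R I)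
          (α : M →ₗ[R] I) (β : I →ₗ[R] M), Module.Injective R I ∧ IsSES R α β) ∧
        ∃ i : ℕ, 0 < i ∧ ∀ (E : Type u) (_ : AddCommGroup E) (_ : Module R E),
          Module.Injective R E → extVanish R E M i) := by
  let := HasDerivedCategory.standard (ModuleCat.{u} R)
  let := CategoryTheory.hasExt_of_hasDerivedCategory (ModuleCat.{u} R)
  constructor
  · rintro ⟨I, _, _, f, hI, hf, ⟨e⟩, hE⟩
    let α : M →ₗ[R] I := (LinearMap.ker f).subtype.comp e.toLinearMap
    let β : I →ₗ[R] M :=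
      e.symm.toLinearMap.comp (f.codRestrict (LinearMap.ker f) hf.apply_apply_eq_zero)
    have hαβ : ∀ x, α (β x) = f x := fun x => by simp [α, β]; rfl
    have hα : Function.Injective α := Subtype.val_injective.comp e.injective
    have hfα : ∀ m, f (α m) = 0 := fun m => (e m).2
    have h : IsSES R α β := by
      refine ⟨hα, fun x => ⟨fun hx => ?_, ?_⟩, fun m => ?_⟩
      · have : f x = 0 := by rw [← hαβ, hx, map_zero]
        exact ⟨e.symm ⟨x, this⟩, by simp [α]⟩
      · rintro ⟨m, rfl⟩
        apply hα
        rw [hαβ, hfα, map_zero]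
      · obtain ⟨x, hx⟩ := (hf (α m)).1 (hfα m)
        exact ⟨x, hα (by rw [hαβ, hx])⟩
    refine ⟨⟨I, _, _, α, β, hI, h⟩, 1, one_pos, fun E _ _ hEi => ?_⟩
    refine (sgi_one hI h E).2 fun g => ?_
    obtain ⟨k, hk⟩ := (hE E _ _ hEi (α.comp g)).1 (by ext x; exact hfα (g x))
    refine ⟨k, LinearMap.ext fun x => hα ?_⟩
    have := LinearMap.congr_fun hk x
    simpa [hαβ] using this
  · rintro ⟨⟨I, _, _, α, β, hI, h⟩, i, hi, hv⟩
    obtain ⟨n, rfl⟩ : ∃ n, i = n + 1 := ⟨i - 1, by omega⟩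
    have hk0 : ∀ x, (α.comp β) x = 0 ↔ β x = 0 := fun x => by
      rw [LinearMap.comp_apply, map_eq_zero_iff α h.1]
    have hker : LinearMap.ker (α.comp β) = LinearMap.range α := by
      ext x
      rw [LinearMap.mem_ker, hk0]
      exact h.2.1 x
    refine ⟨I, _, _, α.comp β, hI, fun x => ?_, ⟨?_⟩, fun E _ _ hEi g => ?_⟩
    · rw [hk0, h.2.1 x]
      constructor
      · rintro ⟨m, rfl⟩
        obtain ⟨y, rfl⟩ := h.2.2 m
        exact ⟨y, rfl⟩
      · rintro ⟨y, rfl⟩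
        exact ⟨β y, rfl⟩
    · exact (LinearEquiv.ofInjective α h.1).trans (LinearEquiv.ofEq _ _ hker.symm)
    · have hl := (sgi_one hI h E).1 (sgi_down hI h _ n (hv E _ _ hEi))
      constructor
      · intro hg
        have hm : ∀ x, g x ∈ LinearMap.range α := fun x => by
          rw [← hker]; exact LinearMap.congr_fun hg x
        let e := LinearEquiv.ofInjective α h.1
        obtain ⟨k, hk⟩ := hl (e.symm.toLinearMap.comp (g.codRestrict _ hm))
        refine ⟨k, LinearMap.ext fun x => ?_⟩
        have h1 := LinearMap.congr_fun hk x
        have h2 : e (β (k x)) = g.codRestrict _ hm x := by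
          rw [← LinearMap.comp_apply, h1]; simp
        exact congrArg Subtype.val h2
      · rintro ⟨k, rfl⟩
        ext x
        have : β (α (β (k x))) = 0 := h.2.1.apply_apply_eq_zero _
        simp [this]
end

section
/- An R-module is Gorenstein projective if and only if it is a direct summand of a strongly Gorenstein projective R-module. -/
/-! Definitions for Gorenstein homological algebra over an arbitrary
associative ring `R` (left modules; right modules are `Rᵐᵒᵖ`-modules). -/

universe u

/-- Hom-exact short exact sequence `A → P → B` with `P` projective. -/
def GR (R : Type u) [Ring R] (A B : Type u) [AddCommGroup A] [Module R A] [AddCommGroup B]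
    [Module R B] : Prop :=
  ∃ (P : Type u) (_ : AddCommGroup P) (_ : Module R P) (i : A →ₗ[R] P) (p : P →ₗ[R] B),
    Module.Projective R P ∧ Function.Injective i ∧ Function.Exact i p ∧ Function.Surjective p ∧
    ∀ (Q : Type u) (_ : AddCommGroup Q) (_ : Module R Q), Module.Projective R Q →
      ∀ g : A →ₗ[R] Q, ∃ h : P →ₗ[R] Q, ∀ a, h (i a) = g a

/-- `K` is an extension of `C` by `A`. -/
def IsExtn (R : Type u) [Ring R] (A K C : Type u) [AddCommGroup A] [Module R A]
    [AddCommGroup K] [Module R K] [AddCommGroup C] [Module R C] : Prop :=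
  ∃ (f : A →ₗ[R] K) (g : K →ₗ[R] C), IsSES R f g

section Helpers

variable {R : Type u} [Ring R]
variable {A B C D K X : Type u} [AddCommGroup A] [Module R A] [AddCommGroup B] [Module R B]
  [AddCommGroup C] [Module R C] [AddCommGroup D] [Module R D] [AddCommGroup K] [Module R K]
  [AddCommGroup X] [Module R X]

theorem gp_descend (p : A →ₗ[R] B) (hp : Function.Surjective p) (f : A →ₗ[R] C)
    (h : ∀ a, p a = 0 → f a = 0) : ∃ g : B →ₗ[R] C, ∀ a, g (p a) = f a := by
  refine ⟨(LinearMap.ker p).liftQ f (fun a ha => h a ha) ∘ₗ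
    (p.quotKerEquivOfSurjective hp).symm.toLinearMap, fun a => ?_⟩
  have : (p.quotKerEquivOfSurjective hp).symm (p a) = (LinearMap.ker p).mkQ a := by
    rw [LinearEquiv.symm_apply_eq]; rfl
  simp only [LinearMap.comp_apply, LinearEquiv.coe_coe, this]
  rfl

theorem gp_lift (i : A →ₗ[R] B) (hi : Function.Injective i) (f : C →ₗ[R] B)
    (h : ∀ c, ∃ a, i a = f c) : ∃ g : C →ₗ[R] A, ∀ c, i (g c) = f c := by
  refine ⟨(LinearEquiv.ofInjective i hi).symm.toLinearMap ∘ₗ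
    f.codRestrict (LinearMap.range i) (fun c => h c), fun c => ?_⟩
  have := LinearEquiv.apply_symm_apply (LinearEquiv.ofInjective i hi)
    (f.codRestrict (LinearMap.range i) (fun c => h c) c)
  exact congrArg Subtype.val this

theorem GR.congr (h : GR R A B) (e : A ≃ₗ[R] C) (e' : B ≃ₗ[R] D) : GR R C D := by
  obtain ⟨P, _, _, i, p, hP, hi, hip, hp, hQ⟩ := h
  refine ⟨P, _, _, i ∘ₗ e.symm.toLinearMap, e'.toLinearMap ∘ₗ p, hP,
    hi.comp e.symm.injective, ?_, e'.surjective.comp hp, ?_⟩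
  · intro x
    simp only [LinearMap.comp_apply, LinearEquiv.coe_coe, LinearEquiv.map_eq_zero_iff, hip x,
      Set.mem_range]
    constructor
    · rintro ⟨a, rfl⟩; exact ⟨e a, by simp⟩
    · rintro ⟨a, rfl⟩; exact ⟨_, rfl⟩
  · intro Q _ _ hQQ g
    obtain ⟨h, hh⟩ := hQ Q _ _ hQQ (g ∘ₗ e.toLinearMap)
    exact ⟨h, fun a => by simp [hh]⟩


/-- If `D` has a Hom-exact presentation then maps into projectives extend along
monomorphisms with cokernel `D`. -/
theorem GR.extend (hC : GR R C D) (f : A →ₗ[R] K) (g : K →ₗ[R] D) (hs : IsSES R f g)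
    (Q : Type u) [AddCommGroup Q] [Module R Q] (hQQ : Module.Projective R Q) (a : A →ₗ[R] Q) :
    ∃ b : K →ₗ[R] Q, ∀ x, b (f x) = a x := by
  obtain ⟨P, _, _, i, p, hP, hi, hip, hp, hQ⟩ := hC
  obtain ⟨hf, hfg, hg⟩ := hs
  obtain ⟨l, hl⟩ := Module.projective_lifting_property g p hg
  have hl' : ∀ x, g (l x) = p x := fun x => LinearMap.congr_fun hl x
  obtain ⟨m, hm⟩ := gp_lift f hf (l ∘ₗ i) (fun c => (hfg _).1 (by
    simp [hl', hip.apply_apply_eq_zero]))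
  obtain ⟨c, hc⟩ := hQ Q _ _ hQQ (a ∘ₗ m)
  obtain ⟨b, hb⟩ := gp_descend (f.coprod l) (C := Q) (by
      intro k
      obtain ⟨x, hx⟩ := hp (g k)
      obtain ⟨t, ht⟩ := (hfg (k - l x)).1 (by simp [hl', hx])
      exact ⟨(t, x), by simp [ht]⟩) (a.coprod c) (by
      rintro ⟨t, x⟩ h
      simp only [LinearMap.coprod_apply] at h ⊢
      have h1 : p x = 0 := by
        have := congrArg g h
        simpa [hfg.apply_apply_eq_zero, hl'] using this
      obtain ⟨s, rfl⟩ := (hip x).1 h1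
      have h2 : f (t + m s) = 0 := by
        rw [map_add, hm]; exact h
      have h3 : t + m s = 0 := hf (by rw [h2, map_zero])
      rw [hc, LinearMap.comp_apply, ← map_add, h3, map_zero])
  exact ⟨b, fun x => by simpa using hb (x, 0)⟩

theorem GR.forward {A' C' : Type u} [AddCommGroup A'] [Module R A'] [AddCommGroup C']
    [Module R C'] {Z : Type u} [AddCommGroup Z] [Module R Z]
    (hZ : GR R Z C) (hA : GR R A A') (hC : GR R C C') (hK : IsExtn R A K C) :
    ∃ (K' : Type u) (_ : AddCommGroup K') (_ : Module R K'), GR R K K' ∧ IsExtn R A' K' C' := by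
  obtain ⟨f, g, hs⟩ := hK
  obtain ⟨P, _, _, i, p, hP, hi, hip, hp, hQ⟩ := hA
  obtain ⟨P', _, _, i', p', hP', hi', hip', hp', hQ'⟩ := hC
  obtain ⟨h, hh⟩ := hZ.extend f g hs P hP i
  obtain ⟨hf, hfg, hg⟩ := hs
  let k : K →ₗ[R] P × P' := h.prod (i' ∘ₗ g)
  have hk : ∀ x, k x = (h x, i' (g x)) := fun x => rfl
  let K' := (P × P') ⧸ LinearMap.range k
  let q : P × P' →ₗ[R] K' := (LinearMap.range k).mkQ
  have hq : Function.Surjective q := Submodule.mkQ_surjective _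
  have hkq : ∀ x, q x = 0 ↔ ∃ y, k y = x := fun x =>
    Submodule.Quotient.mk_eq_zero _
  refine ⟨K', inferInstance, inferInstance, ⟨P × P', _, _, k, q, inferInstance, ?_,
    hkq, hq, ?_⟩, ?_⟩
  · rw [injective_iff_map_eq_zero]
    intro x hx
    rw [hk, Prod.mk_eq_zero] at hx
    have h1 : g x = 0 := hi' (by rw [hx.2, map_zero])
    obtain ⟨a, rfl⟩ := (hfg x).1 h1
    rw [hh] at hx
    have h2 : a = 0 := hi (by rw [hx.1, map_zero])
    rw [h2, map_zero]
  · intro Q _ _ hQQ b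
    obtain ⟨c, hc⟩ := hQ Q _ _ hQQ (b ∘ₗ f)
    obtain ⟨v, hv⟩ := gp_descend g hg (b - c ∘ₗ h) (by
      intro x hx
      obtain ⟨a, rfl⟩ := (hfg x).1 hx
      simp [hh, hc])
    obtain ⟨w, hw⟩ := hQ' Q _ _ hQQ v
    exact ⟨c.coprod w, fun x => by simp [hk, hw, hv]⟩
  · obtain ⟨f', hf'⟩ := gp_descend p hp (q ∘ₗ LinearMap.inl R P P') (by
      intro x hx
      obtain ⟨a, rfl⟩ := (hip x).1 hx
      exact (hkq _).2 ⟨f a, by simp [hk, hh, hfg.apply_apply_eq_zero]⟩)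
    obtain ⟨g', hg'⟩ := gp_descend q hq (p' ∘ₗ LinearMap.snd R P P') (by
      intro x hx
      obtain ⟨y, rfl⟩ := (hkq _).1 hx
      simp [hk, hip'.apply_apply_eq_zero])
    refine ⟨f', g', ?_, ?_, ?_⟩
    · rw [injective_iff_map_eq_zero]
      intro x hx
      obtain ⟨x, rfl⟩ := hp x
      rw [hf'] at hx
      obtain ⟨y, hy⟩ := (hkq _).1 hx
      simp only [hk, LinearMap.inl_apply, Prod.mk.injEq] at hy
      have h1 : g y = 0 := hi' (by rw [hy.2, map_zero])
      obtain ⟨a, rfl⟩ := (hfg y).1 h1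
      rw [← hy.1, hh, hip.apply_apply_eq_zero]
    · intro x
      obtain ⟨⟨x, y⟩, rfl⟩ := hq x
      rw [hg']
      constructor
      · intro hy
        obtain ⟨c, hc⟩ := (hip' y).1 hy
        obtain ⟨z, rfl⟩ := hg c
        refine ⟨p (x - h z), ?_⟩
        rw [hf', ← sub_eq_zero, LinearMap.comp_apply, ← map_sub]
        exact (hkq _).2 ⟨-z, by simp [hk, hc]⟩
      · rintro ⟨z, hz⟩
        obtain ⟨z, rfl⟩ := hp z
        rw [hf'] at hz
        rw [← hg', ← hz, LinearMap.comp_apply, hg']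
        simp
    · intro c
      obtain ⟨y, rfl⟩ := hp' c
      exact ⟨q (0, y), by rw [hg']; rfl⟩

theorem GR.backward {A' C' : Type u} [AddCommGroup A'] [Module R A'] [AddCommGroup C']
    [Module R C']
    (hA : GR R A' A) (hC : GR R C' C) (hK : IsExtn R A K C) :
    ∃ (K' : Type u) (_ : AddCommGroup K') (_ : Module R K'), GR R K' K ∧ IsExtn R A' K' C' := by
  obtain ⟨f, g, hs⟩ := hK
  obtain ⟨P, _, _, i, p, hP, hi, hip, hp, hQ⟩ := hA
  obtain ⟨P', _, _, i', p', hP', hi', hip', hp', hQ'⟩ := hC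
  obtain ⟨hf, hfg, hg⟩ := hs
  obtain ⟨l, hl⟩ := Module.projective_lifting_property g p' hg
  have hl' : ∀ x, g (l x) = p' x := fun x => LinearMap.congr_fun hl x
  let q : P × P' →ₗ[R] K := (f ∘ₗ p).coprod l
  have hq : ∀ x y, q (x, y) = f (p x) + l y := fun x y => by simp [q]
  let K' := LinearMap.ker q
  obtain ⟨f', hf'⟩ := gp_lift K'.subtype K'.injective_subtype (LinearMap.inl R P P' ∘ₗ i) (by
    intro c
    exact ⟨⟨(i c, 0), by simp [K', hq, hip.apply_apply_eq_zero]⟩, rfl⟩)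
  obtain ⟨g', hg'⟩ := gp_lift i' hi' (LinearMap.snd R P P' ∘ₗ K'.subtype) (by
    rintro ⟨⟨x, y⟩, hxy⟩
    have h0 : f (p x) + l y = 0 := by rw [← hq]; exact hxy
    have := congrArg g h0
    exact (hip' y).1 (by simpa [hfg.apply_apply_eq_zero, hl'] using this))
  have hf1 : ∀ c, (f' c : P × P') = (i c, 0) := hf'
  have hg1 : ∀ c : K', i' (g' c) = (c : P × P').2 := hg'
  have hs' : IsSES R f' g' := by
    refine ⟨?_, ?_, ?_⟩
    · intro x y hxy
      have : (f' x : P × P') = f' y := by rw [hxy]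
      rw [hf1, hf1, Prod.mk.injEq] at this
      exact hi this.1
    · rintro ⟨⟨x, y⟩, hxy⟩
      have h0 : f (p x) + l y = 0 := by rw [← hq]; exact hxy
      constructor
      · intro hc
        have hy : y = 0 := by
          have := hg1 ⟨⟨x, y⟩, hxy⟩
          rw [hc, map_zero] at this
          exact this.symm
        subst hy
        have hx : p x = 0 := hf (by simpa using h0)
        obtain ⟨a, rfl⟩ := (hip x).1 hx
        exact ⟨a, Subtype.ext (hf1 a)⟩
      · rintro ⟨a, ha⟩
        rw [← ha]
        apply hi'
        rw [hg1, hf1, map_zero]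
    · intro c
      obtain ⟨a, ha⟩ := (hfg (l (i' c))).1 (by rw [hl', hip'.apply_apply_eq_zero])
      obtain ⟨x, rfl⟩ := hp a
      refine ⟨⟨(-x, i' c), by simp [K', hq, ha]⟩, hi' ?_⟩
      rw [hg1]
  refine ⟨K', inferInstance, inferInstance, ⟨P × P', _, _, K'.subtype, q, inferInstance,
    K'.injective_subtype, ?_, ?_, ?_⟩, f', g', hs'⟩
  · intro x
    simp [K']
  · intro k
    obtain ⟨y, hy⟩ := hp' (g k)
    obtain ⟨a, ha⟩ := (hfg (k - l y)).1 (by simp [hl', hy])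
    obtain ⟨x, rfl⟩ := hp a
    exact ⟨(x, y), by simp [hq, ha]⟩
  · intro Q _ _ hQQ b
    obtain ⟨hf2, hfg2, hg2⟩ := hs'
    obtain ⟨c, hc⟩ := hQ Q _ _ hQQ (b ∘ₗ f')
    obtain ⟨v, hv⟩ := gp_descend g' hg2 (b - c ∘ₗ LinearMap.fst R P P' ∘ₗ K'.subtype) (by
      intro x hx
      obtain ⟨a, rfl⟩ := (hfg2 x).1 hx
      simp [hf1, hc])
    obtain ⟨w, hw⟩ := hQ' Q _ _ hQQ v
    exact ⟨c.coprod w, fun x => by simp [← hg1, hw, hv]⟩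

variable {M T : Type u} [AddCommGroup M] [Module R M] [AddCommGroup T] [Module R T]

theorem GR.summand_forward (hT : GR R T T) (e : T ≃ₗ[R] M × T) :
    ∃ (K' : Type u) (_ : AddCommGroup K') (_ : Module R K'), GR R M K' ∧ IsExtn R T K' T := by
  obtain ⟨P, _, _, i, p, hP, hi, hip, hp, hQ⟩ := hT
  let k : M →ₗ[R] P := i ∘ₗ e.symm.toLinearMap ∘ₗ LinearMap.inl R M T
  have hk : ∀ m, k m = i (e.symm (m, 0)) := fun _ => rfl
  let q : P →ₗ[R] P ⧸ LinearMap.range k := (LinearMap.range k).mkQ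
  have hq : Function.Surjective q := Submodule.mkQ_surjective _
  have hkq : ∀ x, q x = 0 ↔ ∃ y, k y = x := fun x => by simp [q]
  refine ⟨P ⧸ LinearMap.range k, inferInstance, inferInstance, ⟨P, _, _, k, q, hP, ?_, hkq, hq,
    ?_⟩, ?_⟩
  · intro x y hxy
    have := e.symm.injective (hi hxy)
    simpa using this
  · intro Q _ _ hQQ g
    obtain ⟨h, hh⟩ := hQ Q _ _ hQQ (g ∘ₗ LinearMap.fst R M T ∘ₗ e.toLinearMap)
    exact ⟨h, fun a => by simp [hk, hh]⟩
  · obtain ⟨g', hg'⟩ := gp_descend q hq p (by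
      intro x hx
      obtain ⟨y, rfl⟩ := (hkq _).1 hx
      rw [hk, hip.apply_apply_eq_zero])
    have hf : ∀ t, (q ∘ₗ i ∘ₗ e.symm.toLinearMap ∘ₗ LinearMap.inr R M T) t
      = q (i (e.symm (0, t))) := fun _ => rfl
    refine ⟨q ∘ₗ i ∘ₗ e.symm.toLinearMap ∘ₗ LinearMap.inr R M T, g', ?_, ?_, ?_⟩
    · rw [injective_iff_map_eq_zero]
      intro t ht
      rw [hf] at ht
      obtain ⟨y, hy⟩ := (hkq _).1 ht
      have := e.symm.injective (hi hy)
      simp only [LinearMap.inl_apply, Prod.mk.injEq] at this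
      exact this.2.symm
    · intro x
      obtain ⟨x, rfl⟩ := hq x
      rw [hg']
      constructor
      · intro hx
        obtain ⟨t, rfl⟩ := (hip x).1 hx
        refine ⟨(e t).2, ?_⟩
        rw [hf, ← sub_eq_zero, ← map_sub]
        refine (hkq _).2 ⟨-(e t).1, ?_⟩
        rw [hk, ← map_sub]
        congr 1
        apply e.injective
        ext <;> simp
      · rintro ⟨t, ht⟩
        rw [← hg', ← ht, hf, hg', hip.apply_apply_eq_zero]
    · intro t
      obtain ⟨x, rfl⟩ := hp t
      exact ⟨q x, hg' x⟩

theorem GR.summand_backward (hT : GR R T T) (e : T ≃ₗ[R] M × T) :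
    ∃ (K' : Type u) (_ : AddCommGroup K') (_ : Module R K'), GR R K' M ∧ IsExtn R T K' T := by
  obtain ⟨P, _, _, i, p, hP, hi, hip, hp, hQ⟩ := hT
  let q : P →ₗ[R] M := LinearMap.fst R M T ∘ₗ e.toLinearMap ∘ₗ p
  have hq : ∀ x, q x = (e (p x)).1 := fun _ => rfl
  let K' := LinearMap.ker q
  have hK : ∀ x : K', (e (p x)).1 = 0 := fun x => x.2
  obtain ⟨f', hf'⟩ := gp_lift K'.subtype K'.injective_subtype i (by
    intro c
    exact ⟨⟨i c, by simp [K', hq, hip.apply_apply_eq_zero]⟩, rfl⟩)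
  have hf1 : ∀ c, (f' c : P) = i c := hf'
  let g' : K' →ₗ[R] T := LinearMap.snd R M T ∘ₗ e.toLinearMap ∘ₗ p ∘ₗ K'.subtype
  have hg' : ∀ x, g' x = (e (p x)).2 := fun _ => rfl
  have hs' : IsSES R f' g' := by
    refine ⟨?_, ?_, ?_⟩
    · intro x y hxy
      apply hi
      rw [← hf1, ← hf1, hxy]
    · intro x
      constructor
      · intro hx
        have h0 : e (p x) = 0 := Prod.ext (hK x) (by rw [← hg', hx]; rfl)
        obtain ⟨t, ht⟩ := (hip x).1 (e.map_eq_zero_iff.1 h0)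
        exact ⟨t, Subtype.ext (by rw [hf1, ht])⟩
      · rintro ⟨t, rfl⟩
        rw [hg', hf1, hip.apply_apply_eq_zero]; simp
    · intro t
      obtain ⟨x, hx⟩ := hp (e.symm (0, t))
      exact ⟨⟨x, by simp [K', hq, hx]⟩, by simp [hg', hx]⟩
  refine ⟨K', inferInstance, inferInstance, ⟨P, _, _, K'.subtype, q, hP,
    K'.injective_subtype, ?_, ?_, ?_⟩, f', g', hs'⟩
  · intro x
    simp [K']
  · exact Prod.fst_surjective.comp (e.surjective.comp hp)
  · intro Q _ _ hQQ b
    obtain ⟨hf2, hfg2, hg2⟩ := hs'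
    obtain ⟨c, hc⟩ := hQ Q _ _ hQQ (b ∘ₗ f')
    obtain ⟨v, hv⟩ := gp_descend g' hg2 (b - c ∘ₗ K'.subtype) (by
      intro x hx
      obtain ⟨a, rfl⟩ := (hfg2 x).1 hx
      simp [hf1, hc])
    refine ⟨c + v ∘ₗ LinearMap.snd R M T ∘ₗ e.toLinearMap ∘ₗ p, fun x => ?_⟩
    have := hv x
    rw [hg'] at this
    simp [this]

open scoped DirectSum in
theorem GR.directSum {ι : Type} [DecidableEq ι] (A B : ι → Type u) [∀ i, AddCommGroup (A i)]
    [∀ i, Module R (A i)] [∀ i, AddCommGroup (B i)] [∀ i, Module R (B i)]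
    (h : ∀ i, GR R (A i) (B i)) : GR R (Π₀ i, A i) (Π₀ i, B i) := by
  choose P _ _ f g hP hf hfg hg hQ using h
  refine ⟨Π₀ i, P i, inferInstance, inferInstance, DFinsupp.mapRange.linearMap f,
    DFinsupp.mapRange.linearMap g, ?_, ?_, ?_, ?_, ?_⟩
  · exact inferInstanceAs (Module.Projective R (⨁ i, P i))
  · exact (DFinsupp.mapRange_injective _ (fun i => map_zero _)).2 hf
  · intro x
    constructor
    · intro hx
      have h1 : ∀ i, g i (x i) = 0 := fun i => by
        have := DFunLike.congr_fun hx i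
        simpa using this
      classical
      choose y hy using fun i => (hfg i (x i)).1 (h1 i)
      refine ⟨DFinsupp.mk x.support (fun i => y i), ?_⟩
      ext i
      by_cases hi : i ∈ x.support
      · simp [DFinsupp.mk_apply, hi, hy]
      · have : x i = 0 := by simpa using hi
        simp [DFinsupp.mk_apply, this]
    · rintro ⟨y, rfl⟩
      ext i
      simp [(hfg i).apply_apply_eq_zero]
  · exact (DFinsupp.mapRange_surjective _ (fun i => map_zero _)).2 hg
  · intro Q _ _ hQQ b
    choose c hc using fun i => hQ i Q _ _ hQQ (b ∘ₗ DFinsupp.lsingle i)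
    refine ⟨DFinsupp.lsum ℕ c, fun a => ?_⟩
    have : DFinsupp.lsum ℕ c ∘ₗ DFinsupp.mapRange.linearMap f = b := by
      apply DFinsupp.lhom_ext
      intro i x
      have := hc i x
      simp [this]
    exact LinearMap.congr_fun this a

theorem gp_chain {α : Type*} (r : α → α → Prop) (C : α → Prop)
    (hf : ∀ a, C a → ∃ b, C b ∧ r a b) (hb : ∀ a, C a → ∃ b, C b ∧ r b a) (a : α) (ha : C a) :
    ∃ s : ℤ → α, s 0 = a ∧ ∀ i, r (s i) (s (i + 1)) := by
  choose F hF using fun x : {a // C a} => hf x.1 x.2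
  choose G hG using fun x : {a // C a} => hb x.1 x.2
  let F' : {a // C a} → {a // C a} := fun x => ⟨F x, (hF x).1⟩
  let G' : {a // C a} → {a // C a} := fun x => ⟨G x, (hG x).1⟩
  have hF' : ∀ x, r x.1 (F' x).1 := fun x => (hF x).2
  have hG' : ∀ x, r (G' x).1 x.1 := fun x => (hG x).2
  let s : ℤ → α := fun i => match i with
    | Int.ofNat n => (F'^[n] ⟨a, ha⟩).1
    | Int.negSucc n => (G'^[n+1] ⟨a, ha⟩).1
  refine ⟨s, rfl, ?_⟩
  rintro (n | n)
  · change r (F'^[n] ⟨a, ha⟩).1 (F'^[n+1] ⟨a, ha⟩).1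
    rw [Function.iterate_succ_apply']
    exact hF' _
  · have h : s (Int.negSucc n + 1) = (G'^[n] ⟨a, ha⟩).1 := by
      cases n <;> rfl
    rw [h]
    change r (G'^[n+1] ⟨a, ha⟩).1 _
    rw [Function.iterate_succ_apply']
    exact hG' _

theorem gp_of_chain (s : ℤ → ModuleCat.{u} R) (h : ∀ i, GR R (s i) (s (i + 1))) :
    GorensteinProjective R (s 0) := by
  choose P _ _ f g hP hf hfg hg hQ using h
  have hz : ∀ i x, f (i+1) (g i x) = 0 ↔ g i x = 0 := fun i x =>
    ⟨fun h => hf _ (by rw [h, map_zero]), fun h => by rw [h, map_zero]⟩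
  refine ⟨P, _, _, fun i => f (i+1) ∘ₗ g i, hP, ?_, ⟨?_⟩, ?_⟩
  · intro i x
    simp only [LinearMap.comp_apply, hz]
    rw [hfg (i+1) x]
    constructor
    · rintro ⟨y, rfl⟩
      obtain ⟨z, rfl⟩ := hg i y
      exact ⟨z, rfl⟩
    · rintro ⟨y, rfl⟩
      exact ⟨_, rfl⟩
  · refine (LinearEquiv.ofInjective (f 0) (hf 0)).trans (LinearEquiv.ofEq _ _ ?_)
    ext x
    have := hz 0 x
    rw [LinearMap.mem_ker, LinearMap.comp_apply, this, hfg 0 x]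
    rfl
  · intro Q _ _ hQQ i b
    constructor
    · intro hb
      have hb' : ∀ x, b (f (i+1) (g i x)) = 0 := fun x => LinearMap.congr_fun hb x
      obtain ⟨c, hc⟩ := gp_descend (g (i+1)) (hg _) b (by
        intro x hx
        obtain ⟨y, rfl⟩ := (hfg _ x).1 hx
        obtain ⟨z, rfl⟩ := hg i y
        exact hb' z)
      obtain ⟨d, hd⟩ := hQ (i+1+1) Q _ _ hQQ c
      refine ⟨d, ?_⟩
      ext x
      simp [hd, hc]
    · rintro ⟨c, rfl⟩
      ext x
      simp [(hfg (i+1)).apply_apply_eq_zero]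

theorem sgp_of_gr (h : GR R T T) : StronglyGorensteinProjective R T := by
  obtain ⟨P, _, _, f, g, hP, hf, hfg, hg, hQ⟩ := h
  have hz : ∀ x, f (g x) = 0 ↔ g x = 0 := fun x =>
    ⟨fun h => hf (by rw [h, map_zero]), fun h => by rw [h, map_zero]⟩
  refine ⟨P, _, _, f ∘ₗ g, hP, ?_, ⟨?_⟩, ?_⟩
  · intro x
    simp only [LinearMap.comp_apply, hz]
    rw [hfg x]
    constructor
    · rintro ⟨y, rfl⟩
      obtain ⟨z, rfl⟩ := hg y
      exact ⟨z, rfl⟩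
    · rintro ⟨y, rfl⟩
      exact ⟨_, rfl⟩
  · refine (LinearEquiv.ofInjective f hf).trans (LinearEquiv.ofEq _ _ ?_)
    ext x
    rw [LinearMap.mem_ker, LinearMap.comp_apply, hz, hfg x]
    rfl
  · intro Q _ _ hQQ b
    constructor
    · intro hb
      have hb' : ∀ x, b (f (g x)) = 0 := fun x => LinearMap.congr_fun hb x
      obtain ⟨c, hc⟩ := gp_descend g hg b (by
        intro x hx
        obtain ⟨y, rfl⟩ := (hfg x).1 hx
        obtain ⟨z, rfl⟩ := hg y
        exact hb' z)
      obtain ⟨d, hd⟩ := hQ Q _ _ hQQ c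
      refine ⟨d, ?_⟩
      ext x
      simp [hd, hc]
    · rintro ⟨c, rfl⟩
      ext x
      simp [hfg.apply_apply_eq_zero]

/-- The key Hom-exact piece: three consecutive maps in a complete resolution. -/
theorem gr_of_exact {P0 P1 P2 P3 : Type u} [AddCommGroup P0] [Module R P0]
    [AddCommGroup P1] [Module R P1] [AddCommGroup P2] [Module R P2]
    [AddCommGroup P3] [Module R P3] (hP : Module.Projective R P2)
    (d0 : P0 →ₗ[R] P1) (d1 : P1 →ₗ[R] P2) (d2 : P2 →ₗ[R] P3)
    {P4 : Type u} [AddCommGroup P4] [Module R P4] (d3 : P3 →ₗ[R] P4)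
    (h01 : Function.Exact d0 d1) (h12 : Function.Exact d1 d2) (h23 : Function.Exact d2 d3)
    (hQ : ∀ (Q : Type u) (_ : AddCommGroup Q) (_ : Module R Q), Module.Projective R Q →
      Function.Exact (fun g : P2 →ₗ[R] Q => g.comp d1) (fun g : P1 →ₗ[R] Q => g.comp d0)) :
    GR R (LinearMap.ker d2) (LinearMap.ker d3) := by
  obtain ⟨g, hg⟩ := gp_lift (LinearMap.ker d3).subtype (Submodule.injective_subtype _) d2
    (fun c => ⟨⟨d2 c, h23.apply_apply_eq_zero c⟩, rfl⟩)
  have hg' : ∀ x, (g x : P3) = d2 x := hg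
  refine ⟨P2, _, _, (LinearMap.ker d2).subtype, g, hP, Submodule.injective_subtype _, ?_, ?_, ?_⟩
  · intro x
    rw [← Subtype.coe_inj, hg']
    simp
  · rintro ⟨x, hx⟩
    obtain ⟨y, rfl⟩ := (h23 x).1 hx
    exact ⟨y, Subtype.ext (hg' y)⟩
  · intro Q _ _ hQQ b
    let k : P1 →ₗ[R] LinearMap.ker d2 := d1.codRestrict _ (fun c => h12.apply_apply_eq_zero c)
    obtain ⟨c, hc⟩ := (hQ Q _ _ hQQ (b ∘ₗ k)).1 (by
      ext x
      have : k (d0 x) = 0 := Subtype.ext (h01.apply_apply_eq_zero x)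
      simp [this])
    refine ⟨c, ?_⟩
    rintro ⟨x, hx⟩
    obtain ⟨y, rfl⟩ := (h12 x).1 hx
    exact LinearMap.congr_fun hc y

end Helpers

theorem gp_split {A B : Type u} {R : Type u} [Ring R] [AddCommGroup A] [Module R A]
    [AddCommGroup B] [Module R B] (s : A →ₗ[R] B) (q : B →ₗ[R] A) (h : ∀ a, q (s a) = a) :
    Nonempty (B ≃ₗ[R] A × LinearMap.ker q) := by
  refine ⟨(LinearEquiv.ofBijective (s.coprod (LinearMap.ker q).subtype) ⟨?_, ?_⟩).symm⟩
  · rw [injective_iff_map_eq_zero]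
    rintro ⟨a, x, hx⟩ h0
    simp only [LinearMap.coprod_apply, Submodule.subtype_apply] at h0
    have h1 : a = 0 := by
      have := congrArg q h0
      rw [map_add, h, LinearMap.mem_ker.1 hx] at this
      simpa using this
    subst h1
    have h2 : x = 0 := by simpa using h0
    subst h2
    rfl
  · intro b
    exact ⟨(q b, ⟨b - s (q b), by simp [h]⟩), by simp⟩

noncomputable def gpFinsuppProd (R M N : Type u) [Ring R] [AddCommGroup M] [Module R M]
    [AddCommGroup N] [Module R N] : (ℕ →₀ M × N) ≃ₗ[R] (ℕ →₀ M) × (ℕ →₀ N) :=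
  LinearEquiv.ofLinear
    ((Finsupp.mapRange.linearMap (LinearMap.fst R M N)).prod
      (Finsupp.mapRange.linearMap (LinearMap.snd R M N)))
    ((Finsupp.mapRange.linearMap (LinearMap.inl R M N)).coprod
      (Finsupp.mapRange.linearMap (LinearMap.inr R M N)))
    (by
      apply LinearMap.ext
      rintro ⟨x, y⟩
      ext <;> simp)
    (by
      apply LinearMap.ext
      intro x
      ext <;> simp)

noncomputable def gpFinsuppSucc (R M : Type u) [Ring R] [AddCommGroup M] [Module R M] :
    (ℕ →₀ M) ≃ₗ[R] M × (ℕ →₀ M) :=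
  (Finsupp.domLCongr (Equiv.natSumPUnitEquivNat.{0}.symm.trans (Equiv.sumComm _ _))).trans
    ((Finsupp.sumFinsuppLEquivProdFinsupp R).trans
      (LinearEquiv.prodCongr (Finsupp.LinearEquiv.finsuppUnique R M _) (LinearEquiv.refl _ _)))

theorem gp_summand_of_gp (R : Type u) [Ring R] (M : Type u) [AddCommGroup M] [Module R M]
    (h : GorensteinProjective R M) :
      ∃ (S : Type u) (_ : AddCommGroup S) (_ : Module R S),
        StronglyGorensteinProjective R S ∧
        ∃ (N : Type u) (_ : AddCommGroup N) (_ : Module R N),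
          Nonempty (S ≃ₗ[R] M × N) := by
  obtain ⟨P, _, _, d, hP, hd, ⟨e⟩, hQ⟩ := h
  have hr : ∀ j, GR R (LinearMap.ker (d j)) (LinearMap.ker (d (j + 1))) := by
    intro j
    obtain ⟨i, rfl⟩ : ∃ i, j = i + 1 + 1 := ⟨j - 2, by ring⟩
    exact gr_of_exact (hP _) (d i) (d (i+1)) (d (i+1+1)) (d (i+1+1+1)) (hd _) (hd _) (hd _)
      (fun Q _ _ hQQ => hQ Q _ _ hQQ i)
  let A : ℤ → Type u := fun i => LinearMap.ker (d i)
  have hs : GR R (Π₀ i, A i) (Π₀ i, A (i + 1)) := GR.directSum _ _ hr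
  let e1 : (Π₀ i, A i) ≃ₗ[R] (Π₀ i, A (i + 1)) :=
    DirectSum.lequivCongrLeft R (M := A) (Equiv.addRight (1 : ℤ)).symm
  refine ⟨Π₀ i, A i, inferInstance, inferInstance,
    sgp_of_gr (hs.congr (LinearEquiv.refl _ _) e1.symm),
    LinearMap.ker (DFinsupp.lapply 0 : (Π₀ i, A i) →ₗ[R] A 0), inferInstance, inferInstance, ?_⟩
  obtain ⟨e2⟩ := gp_split (DFinsupp.lsingle 0 : A 0 →ₗ[R] (Π₀ i, A i)) (DFinsupp.lapply 0)
    (fun a => by simp)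
  exact ⟨e2.trans (LinearEquiv.prodCongr e.symm (LinearEquiv.refl _ _))⟩

theorem gp_of_summand (R : Type u) [Ring R] (M : Type u) [AddCommGroup M] [Module R M]
    (S : Type u) [AddCommGroup S] [Module R S] (h : StronglyGorensteinProjective R S)
    (N : Type u) [AddCommGroup N] [Module R N] (e : S ≃ₗ[R] M × N) :
    GorensteinProjective R M := by
  obtain ⟨P, _, _, f, hP, hf, ⟨e0⟩, hQ⟩ := h
  have hS : GR R S S :=
    (gr_of_exact hP f f f f hf hf hf hQ).congr e0.symm e0.symm
  classical
  let T : Type u := ℕ →₀ S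
  have hT : GR R T T :=
    (GR.directSum (fun _ : ℕ => S) (fun _ => S) (fun _ => hS)).congr
      (finsuppLequivDFinsupp R).symm (finsuppLequivDFinsupp R).symm
  let eA : T ≃ₗ[R] (ℕ →₀ M) × (ℕ →₀ N) :=
    (Finsupp.mapRange.linearEquiv e).trans (gpFinsuppProd R M N)
  let eT : T ≃ₗ[R] M × T :=
    eA.trans ((LinearEquiv.prodCongr (gpFinsuppSucc R M) (LinearEquiv.refl _ _)).trans
      ((LinearEquiv.prodAssoc R M (ℕ →₀ M) (ℕ →₀ N)).trans
        (LinearEquiv.prodCongr (LinearEquiv.refl _ _) eA.symm)))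
  let C : ModuleCat.{u} R → Prop := fun K => K = ModuleCat.of R M ∨ IsExtn R T K T
  obtain ⟨s, hs0, hs⟩ := gp_chain (fun A B : ModuleCat.{u} R => GR R A B) C (by
      rintro K (rfl | hK)
      · obtain ⟨K', _, _, h1, h2⟩ := hT.summand_forward eT
        exact ⟨ModuleCat.of R K', Or.inr h2, h1⟩
      · obtain ⟨K', _, _, h1, h2⟩ := GR.forward hT hT hT hK
        exact ⟨ModuleCat.of R K', Or.inr h2, h1⟩) (by
      rintro K (rfl | hK)
      · obtain ⟨K', _, _, h1, h2⟩ := hT.summand_backward eT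
        exact ⟨ModuleCat.of R K', Or.inr h2, h1⟩
      · obtain ⟨K', _, _, h1, h2⟩ := GR.backward hT hT hK
        exact ⟨ModuleCat.of R K', Or.inr h2, h1⟩) (ModuleCat.of R M) (Or.inl rfl)
  have := gp_of_chain s hs
  rw [hs0] at this
  exact this

/-- An `R`-module is Gorenstein projective if and only if it is a direct summand of a
strongly Gorenstein projective `R`-module. -/
theorem gorenstein_projective_iff_direct_summand (R : Type u) [Ring R]
    (M : Type u) [AddCommGroup M] [Module R M] :
    GorensteinProjective R M ↔
      ∃ (S : Type u) (_ : AddCommGroup S) (_ : Module R S),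
        StronglyGorensteinProjective R S ∧
        ∃ (N : Type u) (_ : AddCommGroup N) (_ : Module R N),
          Nonempty (S ≃ₗ[R] M × N) := by
  constructor
  · exact gp_summand_of_gp R M
  · rintro ⟨S, _, _, hS, N, _, _, ⟨e⟩⟩
    exact gp_of_summand R M S hS N e
end

section
/- Suppose the supremum of Gorenstein projective dimensions of all left R-modules is finite. Then for a positive integer n, this supremum is at most n if and only if every R-module P of finite projective dimension has injective dimension at most n. -/
/-! Definitions for Gorenstein homological algebra over an arbitrary
associative ring `R` (left modules; right modules are `Rᵐᵒᵖ`-modules). -/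

universe u

open CategoryTheory CategoryTheory.Abelian

section Interface

variable {R : Type u} [Ring R]

/-- vanishing of Ext -/
def ExtV (R : Type u) [Ring R] (M Q : Type u) [AddCommGroup M] [Module R M] [AddCommGroup Q]
    [Module R Q] (i : ℕ) : Prop :=
  Subsingleton (Ext.{u} (ModuleCat.of R M) (ModuleCat.of R Q) i)

variable {A B C X Q : Type u} [AddCommGroup A] [Module R A] [AddCommGroup B] [Module R B]
    [AddCommGroup C] [Module R C] [AddCommGroup X] [Module R X] [AddCommGroup Q] [Module R Q]

theorem ExtV.eq_zero {i : ℕ} (h : ExtV R A B i)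
    (x : Ext.{u} (ModuleCat.of R A) (ModuleCat.of R B) i) : x = 0 :=
  h.elim _ _

theorem ExtV.mk {i : ℕ} (h : ∀ x : Ext.{u} (ModuleCat.of R A) (ModuleCat.of R B) i, x = 0) :
    ExtV R A B i := subsingleton_of_forall_eq 0 h

/-- the categorical short complex -/
abbrev IsSES.sc {f : A →ₗ[R] B} {g : B →ₗ[R] C} (h : IsSES R f g) :
    ShortComplex (ModuleCat.{u} R) :=
  ShortComplex.mk (ModuleCat.ofHom f) (ModuleCat.ofHom g) (by
    rw [← ModuleCat.ofHom_comp, h.2.1.linearMap_comp_eq_zero]; rfl)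

theorem IsSES.sc_exact {f : A →ₗ[R] B} {g : B →ₗ[R] C} (h : IsSES R f g) :
    h.sc.ShortExact where
  exact := (ShortComplex.ShortExact.moduleCat_exact_iff_function_exact _).2 h.2.1
  mono_f := (ModuleCat.mono_iff_injective _).2 h.1
  epi_g := (ModuleCat.epi_iff_surjective _).2 h.2.2

variable {f : A →ₗ[R] B} {g : B →ₗ[R] C}

theorem ExtV.contra3 (h : IsSES R f g) {i : ℕ} (hA : ExtV R A Q i) (hB : ExtV R B Q (i+1)) : ExtV R C Q (i+1) := by
  refine .mk fun x => ?_
  obtain ⟨y, rfl⟩ := Ext.contravariant_sequence_exact₃ h.sc_exact _ x (hB.eq_zero _)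
    (n₀ := i) (by omega)
  rw [hA.eq_zero y, Ext.comp_zero]

theorem ExtV.contra1 (h : IsSES R f g) {i : ℕ} (hB : ExtV R B Q i) (hC : ExtV R C Q (i+1)) : ExtV R A Q i := by
  refine .mk fun x => ?_
  obtain ⟨y, rfl⟩ := Ext.contravariant_sequence_exact₁ h.sc_exact _ x (n₁ := i+1) (by omega)
    (hC.eq_zero _)
  rw [hB.eq_zero y, Ext.comp_zero]

theorem ExtV.contra2 (h : IsSES R f g) {i : ℕ} (hA : ExtV R A Q i) (hC : ExtV R C Q i) : ExtV R B Q i := by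
  refine .mk fun x => ?_
  obtain ⟨y, rfl⟩ := Ext.contravariant_sequence_exact₂ h.sc_exact _ x
    (hA.eq_zero _)
  rw [hC.eq_zero y, Ext.comp_zero]

theorem ExtV.cov3 (h : IsSES R f g) {i : ℕ} (hB : ExtV R X B i) (hA : ExtV R X A (i+1)) : ExtV R X C i := by
  refine .mk fun x => ?_
  obtain ⟨y, rfl⟩ := Ext.covariant_sequence_exact₃ _ h.sc_exact x rfl (hA.eq_zero _)
  rw [hB.eq_zero y, Ext.zero_comp]

theorem ExtV.cov1 (h : IsSES R f g) {i : ℕ} (hC : ExtV R X C i) (hB : ExtV R X B (i+1)) : ExtV R X A (i+1) := by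
  refine .mk fun x => ?_
  obtain ⟨y, rfl⟩ := Ext.covariant_sequence_exact₁ _ h.sc_exact x (hB.eq_zero _) rfl
  rw [hC.eq_zero y, Ext.zero_comp]

theorem ExtV.extend (h : IsSES R f g) (hC : ExtV R C Q 1) (φ : A →ₗ[R] Q) : ∃ ψ : B →ₗ[R] Q, ψ ∘ₗ f = φ := by
  obtain ⟨y, hy⟩ := Ext.contravariant_sequence_exact₁ h.sc_exact _
    (Ext.mk₀ (ModuleCat.ofHom φ)) (n₁ := 1) rfl (hC.eq_zero _)
  obtain ⟨y, rfl⟩ := Ext.homEquiv₀.symm.surjective y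
  simp only [Ext.homEquiv₀_symm_apply, Ext.mk₀_comp_mk₀] at hy
  have := (Ext.mk₀_bijective _ _).1 hy
  refine ⟨y.hom, ?_⟩
  have := congrArg ModuleCat.Hom.hom this
  simpa using this

theorem ExtV.lift (h : IsSES R f g) (hA : ExtV R X A 1) (φ : X →ₗ[R] C) : ∃ ψ : X →ₗ[R] B, g ∘ₗ ψ = φ := by
  obtain ⟨y, hy⟩ := Ext.covariant_sequence_exact₃ _ h.sc_exact
    (Ext.mk₀ (ModuleCat.ofHom φ)) (n₁ := 1) rfl (hA.eq_zero _)
  obtain ⟨y, rfl⟩ := Ext.homEquiv₀.symm.surjective y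
  simp only [Ext.homEquiv₀_symm_apply, Ext.mk₀_comp_mk₀] at hy
  have := (Ext.mk₀_bijective _ _).1 hy
  refine ⟨y.hom, ?_⟩
  have := congrArg ModuleCat.Hom.hom this
  simpa using this

theorem ExtV.of_extend (h : IsSES R f g) (hB : ExtV R B Q 1)
    (H : ∀ φ : A →ₗ[R] Q, ∃ ψ : B →ₗ[R] Q, ψ ∘ₗ f = φ) : ExtV R C Q 1 := by
  refine .mk fun x => ?_
  obtain ⟨y, rfl⟩ := Ext.contravariant_sequence_exact₃ h.sc_exact _ x (hB.eq_zero _)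
    (n₀ := 0) (by omega)
  obtain ⟨y, rfl⟩ := Ext.homEquiv₀.symm.surjective y
  obtain ⟨ψ, hψ⟩ := H y.hom
  have : y = h.sc.f ≫ ModuleCat.ofHom ψ := by
    ext1; simpa using hψ.symm
  rw [Ext.homEquiv₀_symm_apply, this, ← Ext.mk₀_comp_mk₀, ← Ext.comp_assoc_of_second_deg_zero,
    ShortComplex.ShortExact.extClass_comp, Ext.zero_comp]

theorem ExtV.of_projective [Module.Projective R X] (i : ℕ) : ExtV R X Q (i+1) := by
  have : Projective (ModuleCat.of R X) := (IsProjective.iff_projective (R := R) X).1 inferInstance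
  exact Ext.subsingleton_of_projective _ _ _

theorem ExtV.of_injective (hQ : Module.Injective R Q) (i : ℕ) : ExtV R X Q (i+1) := by
  have : Injective (ModuleCat.of R Q) := (Module.injective_iff_injective_object (R := R) Q).1 hQ
  exact Ext.subsingleton_of_injective _ _ _

theorem injective_of_extV (H : ∀ (X : Type u) [AddCommGroup X] [Module R X], ExtV R X Q 1) :
    Module.Injective R Q := by
  refine (Module.injective_iff_injective_object (R := R) Q).2 ?_
  exact injective_iff_subsingleton_ext_one.2 fun Y => H Y

theorem ExtV.congr_left (e : A ≃ₗ[R] B) {i : ℕ} (hB : ExtV R B Q i) : ExtV R A Q i := by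
  refine .mk fun x => ?_
  have : x = (Ext.mk₀ (ModuleCat.ofHom e.toLinearMap)).comp
      ((Ext.mk₀ (ModuleCat.ofHom e.symm.toLinearMap)).comp x (zero_add i)) (zero_add i) := by
    rw [Ext.mk₀_comp_mk₀_assoc]
    rw [← ModuleCat.ofHom_comp]
    simp
  rw [this, hB.eq_zero ((Ext.mk₀ (ModuleCat.ofHom e.symm.toLinearMap)).comp x (zero_add i)),
    Ext.comp_zero]

theorem ExtV.congr_right (e : A ≃ₗ[R] B) {i : ℕ} (hB : ExtV R X B i) : ExtV R X A i := by
  refine .mk fun x => ?_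
  have : x = (x.comp (Ext.mk₀ (ModuleCat.ofHom e.toLinearMap)) (add_zero i)).comp
      (Ext.mk₀ (ModuleCat.ofHom e.symm.toLinearMap)) (add_zero i) := by
    rw [Ext.comp_assoc_of_third_deg_zero, Ext.mk₀_comp_mk₀, ← ModuleCat.ofHom_comp]
    simp
  rw [this, hB.eq_zero (x.comp (Ext.mk₀ (ModuleCat.ofHom e.toLinearMap)) (add_zero i)),
    Ext.zero_comp]

end Interface

section Resolutions

variable {R : Type u} [Ring R]

theorem IsSES.ker {A B : Type u} [AddCommGroup A] [Module R A] [AddCommGroup B] [Module R B]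
    (g : A →ₗ[R] B) (hg : Function.Surjective g) : IsSES R (LinearMap.ker g).subtype g :=
  ⟨Subtype.val_injective, LinearMap.exact_subtype_ker_map g, hg⟩

theorem IsSES.coker {A B : Type u} [AddCommGroup A] [Module R A] [AddCommGroup B] [Module R B]
    (g : A →ₗ[R] B) (hg : Function.Injective g) : IsSES R g (LinearMap.range g).mkQ :=
  ⟨hg, LinearMap.exact_map_mkQ_range g, Submodule.mkQ_surjective _⟩

theorem exists_factor {A B C : Type u} [AddCommGroup A] [Module R A] [AddCommGroup B] [Module R B]
    [AddCommGroup C] [Module R C] (p : A →ₗ[R] B) (hp : Function.Surjective p) (φ : A →ₗ[R] C)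
    (h : ∀ x, p x = 0 → φ x = 0) : ∃ ψ : B →ₗ[R] C, ∀ x, ψ (p x) = φ x := by
  refine ⟨(Submodule.liftQ (LinearMap.ker p) φ (fun x hx => h x hx)) ∘ₗ
    (p.quotKerEquivOfSurjective hp).symm.toLinearMap, fun x => ?_⟩
  have : (p.quotKerEquivOfSurjective hp).symm (p x) = Submodule.Quotient.mk x := by
    rw [LinearEquiv.symm_apply_eq]; rfl
  rw [LinearMap.comp_apply, LinearEquiv.coe_coe, this]
  rfl

theorem exists_proj_cover (M : Type u) [AddCommGroup M] [Module R M] :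
    ∃ (P : Type u) (_ : AddCommGroup P) (_ : Module R P) (g : P →ₗ[R] M),
      Module.Projective R P ∧ Function.Surjective g :=
  ⟨M →₀ R, inferInstance, inferInstance, Finsupp.linearCombination R id, inferInstance,
    fun m => ⟨Finsupp.single m 1, by simp⟩⟩

theorem exists_inj_hull (M : Type u) [AddCommGroup M] [Module R M] :
    ∃ (P : Type u) (_ : AddCommGroup P) (_ : Module R P) (g : M →ₗ[R] P),
      Module.Injective R P ∧ Function.Injective g := by
  refine ⟨(CategoryTheory.Injective.under (ModuleCat.of R M) : ModuleCat.{u} R), inferInstance,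
    inferInstance, (CategoryTheory.Injective.ι (ModuleCat.of R M)).hom, ?_, ?_⟩
  · refine (Module.injective_iff_injective_object (R := R) _).2 ?_
    exact inferInstanceAs (CategoryTheory.Injective
      (CategoryTheory.Injective.under (ModuleCat.of R M)))
  · exact (ModuleCat.mono_iff_injective _).1 inferInstance

variable {𝒢 : ∀ (N : Type u) [AddCommGroup N] [Module R N], Prop}

theorem HasLeftResolutionLE.zero_equiv {M : Type u} [AddCommGroup M] [Module R M]
    (h : HasLeftResolutionLE R 𝒢 M 0) :
    ∃ (G : Type u) (_ : AddCommGroup G) (_ : Module R G), 𝒢 G ∧ Nonempty (M ≃ₗ[R] G) := by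
  obtain ⟨G, _, _, d, π, hG, hs, hπ, h0, h1⟩ := h
  refine ⟨G 0, _, _, hG 0, ⟨(LinearEquiv.ofBijective π ⟨?_, hπ⟩).symm⟩⟩
  rw [injective_iff_map_eq_zero]
  intro x hx
  obtain ⟨y, rfl⟩ := (h0 x).1 hx
  have := hs 1 (by omega)
  rw [Subsingleton.elim y 0, map_zero]

theorem HasLeftResolutionLE.succ_ses {M : Type u} [AddCommGroup M] [Module R M] {n : ℕ}
    (h : HasLeftResolutionLE R 𝒢 M (n+1)) :
    ∃ (G : Type u) (_ : AddCommGroup G) (_ : Module R G) (K : Type u) (_ : AddCommGroup K)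
      (_ : Module R K) (f : K →ₗ[R] G) (g : G →ₗ[R] M),
      𝒢 G ∧ HasLeftResolutionLE R 𝒢 K n ∧ IsSES R f g := by
  obtain ⟨G, _, _, d, π, hG, hs, hπ, h0, h1⟩ := h
  refine ⟨G 0, _, _, LinearMap.ker π, _, _, (LinearMap.ker π).subtype, π, hG 0, ?_, .ker π hπ⟩
  refine ⟨fun i => G (i+1), _, _, fun i => d (i+1),
    (d 0).codRestrict (LinearMap.ker π) fun x => (h0 _).2 ⟨x, rfl⟩, fun i => hG _,
    fun i hi => hs _ (by omega), ?_, ?_, fun i => h1 _⟩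
  · rintro ⟨x, hx⟩
    obtain ⟨y, rfl⟩ := (h0 x).1 hx
    exact ⟨y, rfl⟩
  · intro x
    rw [← h1 0 x, ← Subtype.coe_inj]
    rfl

theorem HasRightResolutionLE.zero_equiv {M : Type u} [AddCommGroup M] [Module R M]
    (h : HasRightResolutionLE R 𝒢 M 0) :
    ∃ (G : Type u) (_ : AddCommGroup G) (_ : Module R G), 𝒢 G ∧ Nonempty (M ≃ₗ[R] G) := by
  obtain ⟨G, _, _, d, ι, hG, hs, hι, h0, h1⟩ := h
  refine ⟨G 0, _, _, hG 0, ⟨(LinearEquiv.ofBijective ι ⟨hι, ?_⟩)⟩⟩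
  intro x
  have := hs 1 (by omega)
  exact (h0 x).1 (Subsingleton.elim _ _)

theorem HasRightResolutionLE.succ_ses {M : Type u} [AddCommGroup M] [Module R M] {n : ℕ}
    (h : HasRightResolutionLE R 𝒢 M (n+1)) :
    ∃ (G : Type u) (_ : AddCommGroup G) (_ : Module R G) (K : Type u) (_ : AddCommGroup K)
      (_ : Module R K) (f : M →ₗ[R] G) (g : G →ₗ[R] K),
      𝒢 G ∧ HasRightResolutionLE R 𝒢 K n ∧ IsSES R f g := by
  obtain ⟨G, _, _, d, ι, hG, hs, hι, h0, h1⟩ := h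
  refine ⟨G 0, _, _, LinearMap.range (d 0), _, _, ι, (d 0).rangeRestrict, hG 0, ?_, hι, ?_,
    LinearMap.surjective_rangeRestrict _⟩
  · refine ⟨fun i => G (i+1), _, _, fun i => d (i+1),
      (LinearMap.range (d 0)).subtype, fun i => hG _,
      fun i hi => hs _ (by omega), Subtype.val_injective, ?_, fun i => h1 _⟩
    intro x
    rw [h1 0 x]
    simp
  · intro x
    rw [← h0 x, ← Subtype.coe_inj]
    rfl

theorem HasLeftResolutionLE.of_self {M : Type u} [AddCommGroup M] [Module R M]
    (h : 𝒢 M) (h0 : 𝒢 PUnit.{u+1}) : HasLeftResolutionLE R 𝒢 M 0 := by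
  refine ⟨fun i => (Nat.casesOn i (ModuleCat.of R M) fun _ => ModuleCat.of R PUnit.{u+1} :
    ModuleCat.{u} R), fun i => inferInstance, fun i => inferInstance, fun i => 0,
    LinearMap.id, ?_, ?_, Function.surjective_id, ?_, ?_⟩
  · rintro (_ | i)
    · exact h
    · exact h0
  · rintro (_ | i) hi
    · omega
    · exact inferInstanceAs (Subsingleton PUnit)
  · intro x
    simp [eq_comm]
  · intro i x
    have : Subsingleton ((Nat.casesOn (i+1) (ModuleCat.of R M) fun _ => ModuleCat.of R PUnit.{u+1} :
      ModuleCat.{u} R)) := inferInstanceAs (Subsingleton PUnit)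
    exact ⟨fun _ => ⟨0, Subsingleton.elim _ _⟩, fun _ => rfl⟩

theorem exact_comp_surj {A B C D : Type u} [AddCommGroup A] [Module R A] [AddCommGroup B]
    [Module R B] [AddCommGroup C] [Module R C] [AddCommGroup D] [Module R D] {p : A →ₗ[R] B}
    {f : B →ₗ[R] C} {g : C →ₗ[R] D} (hp : Function.Surjective p) (h : Function.Exact f g) :
    Function.Exact (f ∘ₗ p) g := by
  intro x
  rw [h x]
  constructor
  · rintro ⟨y, rfl⟩
    obtain ⟨z, rfl⟩ := hp y
    exact ⟨z, rfl⟩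
  · rintro ⟨y, rfl⟩
    exact ⟨p y, rfl⟩

theorem exact_comp_inj {A B C D : Type u} [AddCommGroup A] [Module R A] [AddCommGroup B]
    [Module R B] [AddCommGroup C] [Module R C] [AddCommGroup D] [Module R D] {j : C →ₗ[R] D}
    {f : A →ₗ[R] B} {g : B →ₗ[R] C} (hj : Function.Injective j) (h : Function.Exact f g) :
    Function.Exact f (j ∘ₗ g) := by
  intro x
  rw [← h x, ← map_eq_zero_iff j hj]
  rfl

theorem HasLeftResolutionLE.of_ses {M G K : Type u} [AddCommGroup M] [Module R M]
    [AddCommGroup G] [Module R G] [AddCommGroup K] [Module R K] {f : K →ₗ[R] G} {g : G →ₗ[R] M}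
    (hfg : IsSES R f g) (hG : 𝒢 G) {n : ℕ}
    (h : HasLeftResolutionLE R 𝒢 K n) : HasLeftResolutionLE R 𝒢 M (n+1) := by
  obtain ⟨F, _, _, d, π, hF, hs, hπ, h0, h1⟩ := h
  let F' : ℕ → ModuleCat.{u} R := fun i => Nat.casesOn i (ModuleCat.of R G)
    fun i => ModuleCat.of R (F i)
  let d' : ∀ i, F' (i+1) ⟶ F' i := fun i => Nat.casesOn (motive := fun i => F' (i+1) ⟶ F' i) i
    (ModuleCat.ofHom (f ∘ₗ π)) (fun i => ModuleCat.ofHom (d i))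
  refine ⟨fun i => (F' i).carrier, fun i => (F' i).isAddCommGroup, fun i => (F' i).isModule, fun i => (d' i).hom,
    (ModuleCat.ofHom g : F' 0 ⟶ ModuleCat.of R M).hom, ?_, ?_, ?_, ?_, ?_⟩
  · rintro (_ | i)
    · exact hG
    · exact hF i
  · rintro (_ | i) hi
    · omega
    · exact hs i (by omega)
  · exact hfg.2.2
  · have := exact_comp_surj hπ hfg.2.1
    exact this
  · rintro (_ | i)
    · have := exact_comp_inj hfg.1 h0
      exact this
    · exact h1 i

theorem HasRightResolutionLE.of_self {M : Type u} [AddCommGroup M] [Module R M]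
    (h : 𝒢 M) (h0 : 𝒢 PUnit.{u+1}) : HasRightResolutionLE R 𝒢 M 0 := by
  refine ⟨fun i => (Nat.casesOn i (ModuleCat.of R M) fun _ => ModuleCat.of R PUnit.{u+1} :
    ModuleCat.{u} R), fun i => inferInstance, fun i => inferInstance, fun i => 0,
    LinearMap.id, ?_, ?_, Function.injective_id, ?_, ?_⟩
  · rintro (_ | i)
    · exact h
    · exact h0
  · rintro (_ | i) hi
    · omega
    · exact inferInstanceAs (Subsingleton PUnit)
  · intro x
    exact ⟨fun _ => ⟨x, rfl⟩, fun _ => rfl⟩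
  · intro i x
    have : Subsingleton ((Nat.casesOn (i+1) (ModuleCat.of R M) fun _ => ModuleCat.of R PUnit.{u+1} :
      ModuleCat.{u} R)) := inferInstanceAs (Subsingleton PUnit)
    exact ⟨fun _ => ⟨0, Subsingleton.elim _ _⟩, fun _ => rfl⟩

theorem HasRightResolutionLE.of_ses {M G K : Type u} [AddCommGroup M] [Module R M]
    [AddCommGroup G] [Module R G] [AddCommGroup K] [Module R K] {f : M →ₗ[R] G} {g : G →ₗ[R] K}
    (hfg : IsSES R f g) (hG : 𝒢 G) {n : ℕ}
    (h : HasRightResolutionLE R 𝒢 K n) : HasRightResolutionLE R 𝒢 M (n+1) := by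
  obtain ⟨F, _, _, d, ι, hF, hs, hι, h0, h1⟩ := h
  let F' : ℕ → ModuleCat.{u} R := fun i => Nat.casesOn i (ModuleCat.of R G)
    fun i => ModuleCat.of R (F i)
  let d' : ∀ i, F' i ⟶ F' (i+1) := fun i => Nat.casesOn (motive := fun i => F' i ⟶ F' (i+1)) i
    (ModuleCat.ofHom (ι ∘ₗ g)) (fun i => ModuleCat.ofHom (d i))
  refine ⟨fun i => (F' i).carrier, fun i => (F' i).isAddCommGroup, fun i => (F' i).isModule, fun i => (d' i).hom,
    (ModuleCat.ofHom f : ModuleCat.of R M ⟶ F' 0).hom, ?_, ?_, ?_, ?_, ?_⟩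
  · rintro (_ | i)
    · exact hG
    · exact hF i
  · rintro (_ | i) hi
    · omega
    · exact hs i (by omega)
  · exact hfg.1
  · have := exact_comp_inj hι hfg.2.1
    exact this
  · rintro (_ | i)
    · have := exact_comp_surj hfg.2.2 h0
      exact this
    · exact h1 i

theorem sInf_coe_le_iff {S : Set ℕ} (n : ℕ) :
    sInf (((↑) : ℕ → ℕ∞) '' S) ≤ n ↔ ∃ m ∈ S, m ≤ n := by
  constructor
  · intro h
    by_contra hc
    push Not at hc
    have : ((n + 1 : ℕ) : ℕ∞) ≤ sInf (((↑) : ℕ → ℕ∞) '' S) := by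
      refine le_sInf ?_
      rintro _ ⟨m, hm, rfl⟩
      exact_mod_cast hc m hm
    have := this.trans h
    norm_cast at this
    omega
  · rintro ⟨m, hm, hmn⟩
    exact (sInf_le (Set.mem_image_of_mem _ hm)).trans (by exact_mod_cast hmn)

theorem HasLeftResolutionLE.mono {M : Type u} [AddCommGroup M] [Module R M] {m n : ℕ}
    (hmn : m ≤ n) (h : HasLeftResolutionLE R 𝒢 M m) : HasLeftResolutionLE R 𝒢 M n := by
  obtain ⟨G, i1, i2, d, π, hG, hs, h'⟩ := h
  exact ⟨G, i1, i2, d, π, hG, fun i hi => hs i (by omega), h'⟩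

theorem HasRightResolutionLE.mono {M : Type u} [AddCommGroup M] [Module R M] {m n : ℕ}
    (hmn : m ≤ n) (h : HasRightResolutionLE R 𝒢 M m) : HasRightResolutionLE R 𝒢 M n := by
  obtain ⟨G, i1, i2, d, π, hG, hs, h'⟩ := h
  exact ⟨G, i1, i2, d, π, hG, fun i hi => hs i (by omega), h'⟩

end Resolutions

section Gorenstein

variable {R : Type u} [Ring R]

/-- all `Ext` into projectives vanish in degrees `> n` -/
def PerpGT (R : Type u) [Ring R] (X : Type u) [AddCommGroup X] [Module R X] (n : ℕ) : Prop :=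
  ∀ (Q : Type u) [AddCommGroup Q] [Module R Q], Module.Projective R Q → ∀ i, ExtV R X Q (n+i+1)

/-- finite projective dimension, inductively -/
inductive FPd (R : Type u) [Ring R] :
    ∀ (M : Type u) (_ : AddCommGroup M) (_ : Module R M), Prop
  | proj (M : Type u) [a : AddCommGroup M] [m : Module R M] (h : Module.Projective R M) :
      FPd R M a m
  | step (K P M : Type u) [aK : AddCommGroup K] [mK : Module R K] [AddCommGroup P] [Module R P]
      [a : AddCommGroup M] [m : Module R M] (f : K →ₗ[R] P) (g : P →ₗ[R] M)
      (hP : Module.Projective R P) (h : IsSES R f g) (hK : FPd R K aK mK) : FPd R M a m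

theorem FPd.of_res {n : ℕ} : ∀ {M : Type u} [a : AddCommGroup M] [m : Module R M],
    HasLeftResolutionLE R (fun N _ _ => Module.Projective R N) M n → FPd R M a m := by
  induction n with
  | zero =>
    intro M _ _ h
    obtain ⟨G, _, _, hG, ⟨e⟩⟩ := h.zero_equiv
    exact .proj _ (.of_equiv e.symm)
  | succ n ih =>
    intro M _ _ h
    obtain ⟨G, _, _, K, _, _, f, g, hG, hK, h⟩ := h.succ_ses
    exact .step _ _ _ f g hG h (ih hK)

theorem FPd.cover {M : Type u} {a : AddCommGroup M} {m : Module R M} (h : FPd R M a m) :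
    ∃ (L : Type u) (aL : AddCommGroup L) (mL : Module R L) (P : Type u) (_ : AddCommGroup P)
      (_ : Module R P) (f : L →ₗ[R] P) (g : P →ₗ[R] M), Module.Projective R P ∧ IsSES R f g ∧
        FPd R L aL mL := by
  cases h with
  | proj _ h =>
    refine ⟨PUnit.{u+1}, inferInstance, inferInstance, M, _, _, 0, LinearMap.id, h, ⟨?_, ?_, ?_⟩,
      .proj _ inferInstance⟩
    · exact Function.injective_of_subsingleton _
    · intro x; simp [eq_comm]
    · exact Function.surjective_id
  | step K P _ f g hP h hK => exact ⟨_, _, _, _, _, _, f, g, hP, h, hK⟩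

theorem PerpGT.fpd {X : Type u} [AddCommGroup X] [Module R X] {n : ℕ} (hX : PerpGT R X n)
    {M : Type u} {a : AddCommGroup M} {m : Module R M} (h : FPd R M a m) :
    ∀ i, ExtV R X M (n+i+1) := by
  induction h with
  | proj M h => exact hX M h
  | step K P M f g hP h hK ih => exact fun i => .cov3 h (hX P hP i) (ih (i+1))

theorem PerpGT.of_equiv {X Y : Type u} [AddCommGroup X] [Module R X] [AddCommGroup Y] [Module R Y]
    {n : ℕ} (e : X ≃ₗ[R] Y) (h : PerpGT R Y n) : PerpGT R X n :=
  fun Q _ _ hQ i => (h Q hQ i).congr_left e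

/-- `X` is a cycle module of a totally acyclic complex -/
def GPi (R : Type u) [Ring R] (X : Type u) [AddCommGroup X] [Module R X] : Prop :=
  ∃ (P : ℤ → Type u) (_ : ∀ i, AddCommGroup (P i)) (_ : ∀ i, Module R (P i))
    (d : ∀ i, P i →ₗ[R] P (i + 1)) (k : ℤ),
      (∀ i, Module.Projective R (P i)) ∧
      (∀ i, Function.Exact (d i) (d (i + 1))) ∧
      Nonempty (X ≃ₗ[R] LinearMap.ker (d k)) ∧
      (∀ (Q : Type u) (_ : AddCommGroup Q) (_ : Module R Q), Module.Projective R Q →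
        ∀ i, Function.Exact (fun g : P (i + 1 + 1) →ₗ[R] Q => g.comp (d (i + 1)))
          (fun g : P (i + 1) →ₗ[R] Q => g.comp (d i)))

theorem GorensteinProjective.gpi {X : Type u} [AddCommGroup X] [Module R X]
    (h : GorensteinProjective R X) : GPi R X := by
  obtain ⟨P, i1, i2, d, h⟩ := h
  exact ⟨P, i1, i2, d, 0, h⟩

theorem ses_ker {A B C : Type u} [AddCommGroup A] [Module R A] [AddCommGroup B] [Module R B]
    [AddCommGroup C] [Module R C] (f : A →ₗ[R] B) (g : B →ₗ[R] C) (h : Function.Exact f g) :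
    IsSES R (LinearMap.ker f).subtype
      (f.codRestrict (LinearMap.ker g) fun x => (h _).2 ⟨x, rfl⟩) := by
  refine ⟨Subtype.val_injective, ?_, ?_⟩
  · intro x
    simp only [Submodule.coe_subtype, Subtype.range_coe_subtype, Set.mem_ofPred_eq,
      LinearMap.mem_ker]
    rw [← Subtype.coe_inj]
    rfl
  · rintro ⟨x, hx⟩
    obtain ⟨y, rfl⟩ := (h x).1 hx
    exact ⟨y, rfl⟩

theorem IsSES.equiv_left {A B C A' : Type u} [AddCommGroup A] [Module R A] [AddCommGroup B]
    [Module R B] [AddCommGroup C] [Module R C] [AddCommGroup A'] [Module R A'] {f : A →ₗ[R] B}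
    {g : B →ₗ[R] C} (h : IsSES R f g) (e : A' ≃ₗ[R] A) : IsSES R (f ∘ₗ e.toLinearMap) g := by
  refine ⟨h.1.comp e.injective, exact_comp_surj e.surjective h.2.1, h.2.2⟩

theorem GPi.embed {X : Type u} [AddCommGroup X] [Module R X] (h : GPi R X) :
    ∃ (P : Type u) (_ : AddCommGroup P) (_ : Module R P) (Y : Type u) (_ : AddCommGroup Y)
      (_ : Module R Y) (f : X →ₗ[R] P) (g : P →ₗ[R] Y), Module.Projective R P ∧ IsSES R f g ∧
        GPi R Y := by
  obtain ⟨P, i1, i2, d, k, hP, hd, ⟨e⟩, hQ⟩ := h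
  exact ⟨P k, _, _, LinearMap.ker (d (k+1)), _, _, _, _, hP k, (ses_ker _ _ (hd k)).equiv_left e,
    P, i1, i2, d, k+1, hP, hd, ⟨.refl _ _⟩, hQ⟩

theorem GPi.perp {X : Type u} [AddCommGroup X] [Module R X] (h : GPi R X) : PerpGT R X 0 := by
  obtain ⟨P, i1, i2, d, k, hP, hd, ⟨e⟩, hQ⟩ := h
  refine PerpGT.of_equiv e ?_
  clear e
  intro Q _ _ hQp i
  rw [zero_add]
  induction i generalizing k with
  | zero =>
    obtain ⟨k, rfl⟩ : ∃ j, k = j+1+1+1 := ⟨k-3, by omega⟩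
    refine .of_extend (ses_ker (d (k+1+1)) (d (k+1+1+1)) (hd _)) (.of_projective 0) fun φ => ?_
    let d' := (d (k+1)).codRestrict (LinearMap.ker (d (k+1+1))) fun x => (hd _ _).2 ⟨x, rfl⟩
    obtain ⟨ψ, hψ⟩ := (hQ Q _ _ hQp k (φ ∘ₗ d')).1 (by
      ext x
      have : d' (d k x) = 0 := Subtype.ext ((hd k _).2 ⟨x, rfl⟩)
      simp [this])
    refine ⟨ψ, ?_⟩
    ext ⟨x, hx⟩
    obtain ⟨y, rfl⟩ := (hd (k+1) x).1 hx
    exact LinearMap.congr_fun hψ y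
  | succ i ih =>
    obtain ⟨k, rfl⟩ : ∃ j, k = j+1 := ⟨k-1, by omega⟩
    exact .contra3 (ses_ker (d k) (d (k+1)) (hd _)) (ih k) (.of_projective _)

/-- extension closure of the Gorenstein projectives -/
inductive GC (R : Type u) [Ring R] :
    ∀ (M : Type u) (_ : AddCommGroup M) (_ : Module R M), Prop
  | gp (M : Type u) [a : AddCommGroup M] [m : Module R M] (h : GPi R M) :
      GC R M a m
  | ext (A X B : Type u) [aA : AddCommGroup A] [mA : Module R A] [aX : AddCommGroup X]
      [mX : Module R X] [aB : AddCommGroup B] [mB : Module R B] (f : A →ₗ[R] X) (g : X →ₗ[R] B)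
      (h : IsSES R f g) (hA : GC R A aA mA) (hB : GC R B aB mB) : GC R X aX mX

theorem GC.ext1 {M : Type u} {a : AddCommGroup M} {m : Module R M} (h : GC R M a m)
    {Q : Type u} [AddCommGroup Q] [Module R Q] (hQ : Module.Projective R Q) : ExtV R M Q 1 := by
  induction h with
  | gp M h => exact h.perp Q hQ 0
  | ext A X B f g h _ _ ih1 ih2 => exact .contra2 h ih1 ih2

theorem GC.embed {X : Type u} {a : AddCommGroup X} {m : Module R X} (h : GC R X a m) :
    ∃ (P : Type u) (_ : AddCommGroup P) (_ : Module R P) (Y : Type u) (aY : AddCommGroup Y)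
      (mY : Module R Y) (f : X →ₗ[R] P) (g : P →ₗ[R] Y), Module.Projective R P ∧ IsSES R f g ∧
        GC R Y aY mY := by
  induction h with
  | gp M h =>
    obtain ⟨P, _, _, Y, _, _, f, g, hP, h, hY⟩ := h.embed
    exact ⟨P, _, _, Y, _, _, f, g, hP, h, .gp _ hY⟩
  | ext A X B f g h _ hB ih1 ih2 =>
    obtain ⟨PA, _, _, A', _, _, a, πA, hPA, hA, hA'⟩ := ih1
    obtain ⟨PB, _, _, B', _, _, b, πB, hPB, hB2, hB'⟩ := ih2
    obtain ⟨a', ha'⟩ := ExtV.extend h (hB.ext1 hPA) a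
    have ha' : ∀ x, a' (f x) = a x := fun x => LinearMap.congr_fun ha' x
    let F : X →ₗ[R] PA × PB := a'.prod (b ∘ₗ g)
    have hgf : ∀ x, g (f x) = 0 := fun x => (h.2.1 _).2 ⟨x, rfl⟩
    have hF : Function.Injective F := by
      rw [injective_iff_map_eq_zero]
      intro x hx
      have h1 : a' x = 0 := congrArg Prod.fst hx
      have h2 : b (g x) = 0 := congrArg Prod.snd hx
      obtain ⟨y, rfl⟩ := (h.2.1 x).1 ((map_eq_zero_iff b hB2.1).1 h2)
      rw [ha', map_eq_zero_iff a hA.1] at h1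
      rw [h1, map_zero]
    let q := (LinearMap.range F).mkQ
    have hq : ∀ z, q z = 0 ↔ ∃ x, F x = z := fun z => by simp [q]
    obtain ⟨u, hu⟩ := exists_factor πA hA.2.2 (q ∘ₗ LinearMap.inl R PA PB) (fun p hp => by
      obtain ⟨y, rfl⟩ := (hA.2.1 p).1 hp
      exact (hq _).2 ⟨f y, by simp [F, ha', hgf]⟩)
    obtain ⟨v, hv⟩ := exists_factor q (Submodule.mkQ_surjective _)
      (πB ∘ₗ LinearMap.snd R PA PB) (fun p hp => by
      obtain ⟨y, rfl⟩ := (hq _).1 hp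
      exact (hB2.2.1 _).2 ⟨g y, rfl⟩)
    refine ⟨PA × PB, _, _, _, _, _, F, q, inferInstance, .coker F hF,
      .ext A' _ B' u v ⟨?_, ?_, ?_⟩ hA' hB'⟩
    · rw [injective_iff_map_eq_zero]
      intro z hz
      obtain ⟨p, rfl⟩ := hA.2.2 z
      rw [hu] at hz
      obtain ⟨x, hx⟩ := (hq _).1 hz
      have h1 : a' x = p := congrArg Prod.fst hx
      have h2 : b (g x) = 0 := congrArg Prod.snd hx
      obtain ⟨y, rfl⟩ := (h.2.1 x).1 ((map_eq_zero_iff b hB2.1).1 h2)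
      rw [ha'] at h1
      exact (hA.2.1 _).2 ⟨y, h1⟩
    · intro z
      constructor
      · intro hz
        obtain ⟨⟨p, p'⟩, rfl⟩ := Submodule.mkQ_surjective _ z
        have hz : v (q (p, p')) = 0 := hz
        rw [hv] at hz
        obtain ⟨y, hy⟩ := (hB2.2.1 _).1 hz
        obtain ⟨x, rfl⟩ := h.2.2 y
        refine ⟨πA (p - a' x), ?_⟩
        rw [hu]
        change q _ = q _
        rw [← sub_eq_zero, ← map_sub, hq]
        refine ⟨-x, ?_⟩
        have hy : b (g x) = p' := hy
        simp [F, hy]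
      · rintro ⟨z, rfl⟩
        obtain ⟨p, rfl⟩ := hA.2.2 z
        rw [hu]
        exact (hv _).trans (by simp)
    · intro z
      obtain ⟨p, rfl⟩ := hB2.2.2 z
      exact ⟨q (0, p), by rw [hv]; simp⟩

theorem exists_pushout {A B C B' C' : Type u} [AddCommGroup A] [Module R A] [AddCommGroup B]
    [Module R B] [AddCommGroup C] [Module R C] [AddCommGroup B'] [Module R B'] [AddCommGroup C']
    [Module R C'] {f : A →ₗ[R] B} {g : B →ₗ[R] C} {f' : A →ₗ[R] B'} {g' : B' →ₗ[R] C'}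
    (h : IsSES R f g) (h' : IsSES R f' g') :
    ∃ (X : Type u) (_ : AddCommGroup X) (_ : Module R X) (i : B →ₗ[R] X) (p : X →ₗ[R] C')
      (i' : B' →ₗ[R] X) (p' : X →ₗ[R] C), IsSES R i p ∧ IsSES R i' p' := by
  have hgf : ∀ x, g (f x) = 0 := fun x => (h.2.1 _).2 ⟨x, rfl⟩
  have hgf' : ∀ x, g' (f' x) = 0 := fun x => (h'.2.1 _).2 ⟨x, rfl⟩
  let F : A →ₗ[R] B × B' := f.prod f'
  let q := (LinearMap.range F).mkQ
  have hqs : Function.Surjective q := Submodule.mkQ_surjective _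
  have hq : ∀ z, q z = 0 ↔ ∃ x, F x = z := fun z => by simp [q]
  obtain ⟨p, hp⟩ := exists_factor q hqs (g' ∘ₗ LinearMap.snd R B B') (fun z hz => by
    obtain ⟨y, rfl⟩ := (hq _).1 hz
    exact hgf' y)
  obtain ⟨p', hp'⟩ := exists_factor q hqs (g ∘ₗ LinearMap.fst R B B') (fun z hz => by
    obtain ⟨y, rfl⟩ := (hq _).1 hz
    exact hgf y)
  refine ⟨_, _, _, q ∘ₗ LinearMap.inl R B B', p, q ∘ₗ LinearMap.inr R B B', p',
    ⟨?_, ?_, ?_⟩, ⟨?_, ?_, ?_⟩⟩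
  · rw [injective_iff_map_eq_zero]
    intro z hz
    obtain ⟨x, hx⟩ := (hq _).1 hz
    have h1 : f x = z := congrArg Prod.fst hx
    have h2 : f' x = 0 := congrArg Prod.snd hx
    rw [map_eq_zero_iff f' h'.1] at h2
    rw [← h1, h2, map_zero]
  · intro z
    constructor
    · intro hz
      obtain ⟨⟨x, y⟩, rfl⟩ := hqs z
      rw [hp] at hz
      obtain ⟨t, ht⟩ := (h'.2.1 _).1 hz
      have ht : f' t = y := ht
      refine ⟨x - f t, ?_⟩
      change q _ = q _
      rw [← sub_eq_zero, ← map_sub, hq]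
      exact ⟨-t, by simp [F, ht]⟩
    · rintro ⟨z, rfl⟩
      exact (hp _).trans (by simp)
  · intro z
    obtain ⟨y, rfl⟩ := h'.2.2 z
    exact ⟨q (0, y), by rw [hp]; simp⟩
  · rw [injective_iff_map_eq_zero]
    intro z hz
    obtain ⟨x, hx⟩ := (hq _).1 hz
    have h1 : f x = 0 := congrArg Prod.fst hx
    have h2 : f' x = z := congrArg Prod.snd hx
    rw [map_eq_zero_iff f h.1] at h1
    rw [← h2, h1, map_zero]
  · intro z
    constructor
    · intro hz
      obtain ⟨⟨x, y⟩, rfl⟩ := hqs z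
      rw [hp'] at hz
      obtain ⟨t, ht⟩ := (h.2.1 _).1 hz
      have ht : f t = x := ht
      refine ⟨y - f' t, ?_⟩
      change q _ = q _
      rw [← sub_eq_zero, ← map_sub, hq]
      exact ⟨-t, by simp [F, ht]⟩
    · rintro ⟨z, rfl⟩
      exact (hp' _).trans (by simp)
  · intro z
    obtain ⟨y, rfl⟩ := h.2.2 z
    exact ⟨q (y, 0), by rw [hp']; simp⟩

theorem exists_quot {A X M P G : Type u} [AddCommGroup A] [Module R A] [AddCommGroup X]
    [Module R X] [AddCommGroup M] [Module R M] [AddCommGroup P] [Module R P] [AddCommGroup G]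
    [Module R G] {f : A →ₗ[R] X} {g : X →ₗ[R] M} {f' : X →ₗ[R] P} {g' : P →ₗ[R] G}
    (h : IsSES R f g) (h' : IsSES R f' g') :
    ∃ (H : Type u) (_ : AddCommGroup H) (_ : Module R H) (i : A →ₗ[R] P) (p : P →ₗ[R] H)
      (i' : M →ₗ[R] H) (p' : H →ₗ[R] G), IsSES R i p ∧ IsSES R i' p' := by
  let F := f' ∘ₗ f
  have hF : Function.Injective F := h'.1.comp h.1
  let q := (LinearMap.range F).mkQ
  have hqs : Function.Surjective q := Submodule.mkQ_surjective _
  have hq : ∀ z, q z = 0 ↔ ∃ x, F x = z := fun z => by simp [q]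
  obtain ⟨u, hu⟩ := exists_factor g h.2.2 (q ∘ₗ f') (fun z hz => by
    obtain ⟨y, rfl⟩ := (h.2.1 _).1 hz
    exact (hq _).2 ⟨y, rfl⟩)
  obtain ⟨v, hv⟩ := exists_factor q hqs g' (fun z hz => by
    obtain ⟨y, rfl⟩ := (hq _).1 hz
    exact (h'.2.1 _).2 ⟨f y, rfl⟩)
  refine ⟨_, _, _, F, q, u, v, .coker F hF, ?_, ?_, ?_⟩
  · rw [injective_iff_map_eq_zero]
    intro z hz
    obtain ⟨x, rfl⟩ := h.2.2 z
    rw [hu] at hz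
    obtain ⟨y, hy⟩ := (hq _).1 hz
    exact (h.2.1 _).2 ⟨y, h'.1 hy⟩
  · intro z
    constructor
    · intro hz
      obtain ⟨x, rfl⟩ := hqs z
      rw [hv] at hz
      obtain ⟨y, rfl⟩ := (h'.2.1 _).1 hz
      exact ⟨g y, hu y⟩
    · rintro ⟨z, rfl⟩
      obtain ⟨x, rfl⟩ := h.2.2 z
      rw [hu]
      exact (hv _).trans ((h'.2.1 _).2 ⟨x, rfl⟩)
  · intro z
    obtain ⟨y, rfl⟩ := h'.2.2 z
    exact ⟨q y, hv y⟩

theorem exists_fpd_embed {n : ℕ} : ∀ {M : Type u} [AddCommGroup M] [Module R M],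
    HasLeftResolutionLE R (fun N _ _ => GorensteinProjective R N) M n →
    ∃ (H : Type u) (aH : AddCommGroup H) (mH : Module R H) (G : Type u) (aG : AddCommGroup G)
      (mG : Module R G) (f : M →ₗ[R] H) (g : H →ₗ[R] G), IsSES R f g ∧ FPd R H aH mH ∧
        GC R G aG mG := by
  induction n with
  | zero =>
    intro M _ _ h
    obtain ⟨G, _, _, hG, ⟨e⟩⟩ := h.zero_equiv
    obtain ⟨P, _, _, Y, _, _, f, g, hP, h, hY⟩ := hG.gpi.embed
    exact ⟨P, _, _, Y, _, _, _, g, h.equiv_left e, .proj _ hP, .gp _ hY⟩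
  | succ n ih =>
    intro M _ _ h
    obtain ⟨G0, _, _, K, _, _, f, g, hG, hK, h⟩ := h.succ_ses
    obtain ⟨H', _, _, G', _, _, f', g', h', hH', hG'⟩ := ih hK
    obtain ⟨X, _, _, i, p, i', p', hi, hi'⟩ := exists_pushout h h'
    have hX := GC.ext _ _ _ i p hi (.gp _ hG.gpi) hG'
    obtain ⟨P, _, _, Y, _, _, j, r, hP, hj, hY⟩ := hX.embed
    obtain ⟨H, _, _, s, t, s', t', hs, hs'⟩ := exists_quot hi' hj
    exact ⟨H, _, _, Y, _, _, s', t', hs', .step _ _ _ s t hP hs hH', hY⟩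

theorem perp_embed
    (hfin : ∀ (M : Type u) [AddCommGroup M] [Module R M], ∃ n,
      HasLeftResolutionLE R (fun N _ _ => GorensteinProjective R N) M n)
    {K : Type u} [AddCommGroup K] [Module R K] (hK : PerpGT R K 0) :
    ∃ (P : Type u) (_ : AddCommGroup P) (_ : Module R P) (Y : Type u) (_ : AddCommGroup Y)
      (_ : Module R Y) (f : K →ₗ[R] P) (g : P →ₗ[R] Y), Module.Projective R P ∧ IsSES R f g ∧
        PerpGT R Y 0 := by
  obtain ⟨n, hn⟩ := hfin K
  obtain ⟨H, _, _, G, _, _, f, g, h, hH, hG⟩ := exists_fpd_embed hn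
  obtain ⟨L, _, _, P, _, _, i, p, hP, hp, hL⟩ := hH.cover
  obtain ⟨s, hs⟩ := ExtV.lift hp (hK.fpd hL 0) f
  have hsi : Function.Injective s := by
    have := h.1
    rw [← hs] at this
    exact Function.Injective.of_comp this
  have hses := IsSES.coker s hsi
  refine ⟨P, _, _, _, _, _, s, _, hP, hses, ?_⟩
  intro Q _ _ hQ i
  cases i with
  | zero =>
    refine .of_extend hses (.of_projective 0) fun φ => ?_
    obtain ⟨ψ, hψ⟩ := ExtV.extend h (hG.ext1 hQ) φ
    exact ⟨ψ ∘ₗ p, by rw [LinearMap.comp_assoc, hs, hψ]⟩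
  | succ i => exact .contra3 hses (hK Q hQ i) (.of_projective _)

end Gorenstein

section Final

variable {R : Type u} [Ring R]

theorem exists_int_seq {S : Type*} (r : S → S → Prop) (h1 : ∀ a, ∃ b, r a b)
    (h2 : ∀ b, ∃ a, r a b) (x : S) : ∃ Z : ℤ → S, Z 0 = x ∧ ∀ i, r (Z i) (Z (i+1)) := by
  choose s hs using h1
  choose t ht using h2
  let Z : ℤ → S := fun i => Int.casesOn i (fun n => s^[n] x) (fun n => t^[n+1] x)
  refine ⟨Z, rfl, ?_⟩
  rintro (n | n)
  · have : Z (Int.ofNat n + 1) = s (Z (Int.ofNat n)) := Function.iterate_succ_apply' s n x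
    rw [this]
    exact hs _
  · have : Z (Int.negSucc n) = t (Z (Int.negSucc n + 1)) := by
      cases n with
      | zero => rfl
      | succ n => exact Function.iterate_succ_apply' t (n+1) x
    rw [this]
    exact ht _

theorem PerpGT.kernel {X P K : Type u} [AddCommGroup X] [Module R X] [AddCommGroup P] [Module R P]
    [AddCommGroup K] [Module R K] {f : K →ₗ[R] P} {g : P →ₗ[R] X} (h : IsSES R f g)
    (hP : Module.Projective R P) {n m : ℕ} (hnm : n ≤ m + 1) (hX : PerpGT R X n) :
    PerpGT R K m := by
  intro Q _ _ hQ i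
  obtain ⟨j, hj⟩ := Nat.exists_eq_add_of_le hnm
  refine .contra1 h (.of_projective _) ?_
  have := hX Q hQ (j + i)
  rwa [show n + (j + i) + 1 = m + i + 1 + 1 by omega] at this

theorem PerpGT.gorensteinProjective
    (hfin : ∀ (M : Type u) [AddCommGroup M] [Module R M], ∃ n,
      HasLeftResolutionLE R (fun N _ _ => GorensteinProjective R N) M n)
    {K : Type u} [AddCommGroup K] [Module R K] (hK : PerpGT R K 0) :
    GorensteinProjective R K := by
  let S := {X : ModuleCat.{u} R // PerpGT R X 0}
  let r : S → S → Prop := fun X Y => ∃ (P : ModuleCat.{u} R) (f : X.1 →ₗ[R] P)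
    (g : P →ₗ[R] Y.1), Module.Projective R P ∧ IsSES R f g
  obtain ⟨Z, hZ0, hZ⟩ := exists_int_seq r (fun X => by
      obtain ⟨P, _, _, Y, _, _, f, g, hP, h, hY⟩ := perp_embed hfin X.2
      exact ⟨⟨ModuleCat.of R Y, hY⟩, ModuleCat.of R P, f, g, hP, h⟩)
    (fun X => by
      obtain ⟨P, _, _, g, hP, hg⟩ := exists_proj_cover (R := R) X.1
      exact ⟨⟨ModuleCat.of R (LinearMap.ker g), PerpGT.kernel (.ker g hg) hP (by omega) X.2⟩,
        ModuleCat.of R P, _, g, hP, .ker g hg⟩) ⟨ModuleCat.of R K, hK⟩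
  choose P f g hP h using hZ
  have hgf : ∀ i x, g i (f i x) = 0 := fun i x => ((h i).2.1 _).2 ⟨x, rfl⟩
  refine ⟨fun i => (P i).carrier, fun i => (P i).isAddCommGroup, fun i => (P i).isModule,
    fun i => f (i+1) ∘ₗ g i, hP, ?_, ?_, ?_⟩
  · intro i
    exact exact_comp_surj (h i).2.2 (exact_comp_inj (h (i+1+1)).1 (h (i+1)).2.1)
  · have e0 : K ≃ₗ[R] (Z 0).1 := by
      rw [hZ0]
    have e1 : (Z 0).1 ≃ₗ[R] LinearMap.ker (f (0+1) ∘ₗ g 0) := by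
      refine (LinearEquiv.ofInjective (f 0) (h 0).1).trans (LinearEquiv.ofEq _ _ ?_)
      rw [LinearMap.ker_comp_of_ker_eq_bot _ (LinearMap.ker_eq_bot.2 (h (0+1)).1)]
      exact (LinearMap.exact_iff.1 (h 0).2.1).symm
    exact ⟨e0.trans e1⟩
  · intro Q _ _ hQ i φ
    constructor
    · intro hφ
      have hφ0 : ∀ x, φ (f (i+1) x) = 0 := by
        intro x
        obtain ⟨y, rfl⟩ := (h i).2.2 x
        exact LinearMap.congr_fun hφ y
      obtain ⟨ψ, hψ⟩ := exists_factor (g (i+1)) (h (i+1)).2.2 φ (fun x hx => by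
        obtain ⟨y, rfl⟩ := ((h (i+1)).2.1 _).1 hx
        exact hφ0 y)
      obtain ⟨χ, hχ⟩ := ExtV.extend (h (i+1+1)) ((Z (i+1+1+1)).2 Q hQ 0) ψ
      refine ⟨χ, ?_⟩
      refine LinearMap.ext fun x => ?_
      exact (LinearMap.congr_fun hχ (g (i+1) x)).trans (hψ x)
    · rintro ⟨ψ, rfl⟩
      refine LinearMap.ext fun x => ?_
      change ψ (f (i+1+1) (g (i+1) (f (i+1) (g i x)))) = 0
      rw [hgf, map_zero, map_zero]

theorem PerpGT.of_res {n : ℕ} : ∀ {M : Type u} [AddCommGroup M] [Module R M],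
    HasLeftResolutionLE R (fun N _ _ => GorensteinProjective R N) M n → PerpGT R M n := by
  induction n with
  | zero =>
    intro M _ _ h
    obtain ⟨G, _, _, hG, ⟨e⟩⟩ := h.zero_equiv
    exact hG.gpi.perp.of_equiv e
  | succ n ih =>
    intro M _ _ h
    obtain ⟨G0, _, _, K, _, _, f, g, hG, hK, h⟩ := h.succ_ses
    intro Q _ _ hQ i
    refine .contra3 h ?_ ?_
    · have := ih hK Q hQ i
      rwa [show n + i + 1 = n + 1 + i by omega] at this
    · have := hG.gpi.perp Q hQ (n + 1 + i)
      rwa [zero_add] at this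

theorem PerpGT.res
    (hfin : ∀ (M : Type u) [AddCommGroup M] [Module R M], ∃ n,
      HasLeftResolutionLE R (fun N _ _ => GorensteinProjective R N) M n) {n : ℕ} :
    ∀ {M : Type u} [AddCommGroup M] [Module R M], PerpGT R M n →
    HasLeftResolutionLE R (fun N _ _ => GorensteinProjective R N) M n := by
  have hproj : ∀ (P : Type u) [AddCommGroup P] [Module R P], Module.Projective R P →
      GorensteinProjective R P := fun P _ _ hP =>
    PerpGT.gorensteinProjective hfin fun Q _ _ _ i => .of_projective _
  induction n with
  | zero =>
    intro M _ _ h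
    exact .of_self (h.gorensteinProjective hfin) (hproj _ inferInstance)
  | succ n ih =>
    intro M _ _ h
    obtain ⟨P, _, _, g, hP, hg⟩ := exists_proj_cover (R := R) M
    exact .of_ses (.ker g hg) (hproj _ hP) (ih (PerpGT.kernel (.ker g hg) hP le_rfl h))

theorem ext_of_injRes {n : ℕ} : ∀ {Q : Type u} [AddCommGroup Q] [Module R Q],
    HasRightResolutionLE R (fun N _ _ => Module.Injective R N) Q n →
    ∀ (X : Type u) [AddCommGroup X] [Module R X] (i : ℕ), ExtV R X Q (n+i+1) := by
  induction n with
  | zero =>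
    intro M _ _ h X _ _ i
    obtain ⟨G, _, _, hG, ⟨e⟩⟩ := h.zero_equiv
    exact (ExtV.of_injective hG _).congr_right e
  | succ n ih =>
    intro M _ _ h X _ _ i
    obtain ⟨G0, _, _, K, _, _, f, g, hG, hK, h⟩ := h.succ_ses
    refine .cov1 h ?_ (.of_injective hG _)
    have := ih hK X i
    rwa [show n + i + 1 = n + 1 + i by omega] at this

theorem injRes_of_ext {n : ℕ} : ∀ {Q : Type u} [AddCommGroup Q] [Module R Q],
    (∀ (X : Type u) [AddCommGroup X] [Module R X], ExtV R X Q (n+1)) →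
    HasRightResolutionLE R (fun N _ _ => Module.Injective R N) Q n := by
  induction n with
  | zero =>
    intro Q _ _ h
    refine .of_self (injective_of_extV h) ⟨fun X Y _ _ _ _ _ _ _ => ⟨0, fun _ => rfl⟩⟩
  | succ n ih =>
    intro Q _ _ h
    obtain ⟨I, _, _, j, hI, hj⟩ := exists_inj_hull (R := R) Q
    exact .of_ses (.coker j hj) hI (ih fun X _ _ => .cov3 (.coker j hj) (.of_injective hI _) (h X))

end Final

/-- If the supremum of Gorenstein projective dimensions of all left `R`-modules is
finite, then for a positive integer `n`, this supremum is `≤ n` if and only if every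
`R`-module of finite projective dimension has injective dimension `≤ n`. -/
theorem GPgldim_le_iff (R : Type u) [Ring R] (hfin : GPgldim R ≠ ⊤)
    (n : ℕ) (hn : 0 < n) :
    GPgldim R ≤ n ↔
      ∀ (P : Type u) (_ : AddCommGroup P) (_ : Module R P),
        pDim R P ≠ ⊤ → iDim R P ≤ n := by
  have key : ∀ k : ℕ, GPgldim R ≤ k ↔ ∀ (M : Type u) [AddCommGroup M] [Module R M],
      HasLeftResolutionLE R (fun N _ _ => GorensteinProjective R N) M k := by
    intro k
    constructor
    · intro h M _ _
      have hM : gpDim R M ≤ k := by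
        refine le_trans ?_ h
        exact le_sSup ⟨M, _, _, rfl⟩
      obtain ⟨m, hm, hmk⟩ := (sInf_coe_le_iff k).1 hM
      exact HasLeftResolutionLE.mono hmk hm
    · intro h
      refine sSup_le ?_
      rintro _ ⟨M, _, _, rfl⟩
      exact (sInf_coe_le_iff k).2 ⟨k, h M, le_rfl⟩
  have hfin' : ∀ (M : Type u) [AddCommGroup M] [Module R M], ∃ n,
      HasLeftResolutionLE R (fun N _ _ => GorensteinProjective R N) M n := by
    obtain ⟨N, hN⟩ := ENat.ne_top_iff_exists.1 hfin
    exact fun M _ _ => ⟨N, (key N).1 hN.ge M⟩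
  rw [key]
  constructor
  · intro h P _ _ hP
    obtain ⟨m, hm⟩ := ENat.ne_top_iff_exists.1 hP
    obtain ⟨k, hk, -⟩ := (sInf_coe_le_iff m).1 (hm.ge : pDim R P ≤ m)
    have hF := FPd.of_res hk
    refine (sInf_coe_le_iff n).2 ⟨n, injRes_of_ext fun X _ _ => ?_, le_rfl⟩
    exact (PerpGT.of_res (h X)).fpd hF 0
  · intro h M _ _
    refine PerpGT.res hfin' ?_
    intro Q _ _ hQ i
    have hres : HasLeftResolutionLE R (fun N _ _ => Module.Projective R N) Q 0 := by
      have hz : Module.Projective R PUnit.{u+1} := inferInstance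
      exact .of_self hQ hz
    have hQ0 : pDim R Q ≤ (0 : ℕ) := (sInf_coe_le_iff 0).2 ⟨0, hres, le_rfl⟩
    have hi := h Q _ _ (ne_top_of_le_ne_top (ENat.natCast_ne_top 0) hQ0)
    obtain ⟨k, hk, hkn⟩ := (sInf_coe_le_iff n).1 hi
    exact ext_of_injRes (HasRightResolutionLE.mono hkn hk) M i
end

section
/- The supremum over all left R-modules M of the Gorenstein projective dimension Gpd_R(M) equals the supremum over all left R-modules M of the Gorenstein injective dimension Gid_R(M). -/
/-! Definitions for Gorenstein homological algebra over an arbitrary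
associative ring `R` (left modules; right modules are `Rᵐᵒᵖ`-modules). -/

universe u

namespace GorAux

open CategoryTheory CategoryTheory.Limits CategoryTheory.Abelian Opposite
open scoped ZeroObject

set_option linter.unusedSectionVars false
set_option linter.style.haveILetI false

universe w

section Abstract

variable {C : Type*} [Category* C] [Abelian C]

/-- `0 → A → B → D → 0` is short exact. -/
def Ses {A B D : C} (i : A ⟶ B) (p : B ⟶ D) : Prop :=
  ∃ w : i ≫ p = 0, (ShortComplex.mk i p w).ShortExact

lemma Ses.mono {A B D : C} {i : A ⟶ B} {p : B ⟶ D} (h : Ses i p) : Mono i := h.2.mono_f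
lemma Ses.epi {A B D : C} {i : A ⟶ B} {p : B ⟶ D} (h : Ses i p) : Epi p := h.2.epi_g

lemma Ses.op {A B D : C} {i : A ⟶ B} {p : B ⟶ D} (h : Ses i p) : Ses p.op i.op := by
  obtain ⟨w, h⟩ := h
  exact ⟨by rw [← op_comp, w]; rfl, h.op⟩

lemma Ses.unop {A B D : Cᵒᵖ} {i : A ⟶ B} {p : B ⟶ D} (h : Ses i p) : Ses p.unop i.unop := by
  obtain ⟨w, h⟩ := h
  exact ⟨by rw [← unop_comp, w]; rfl, h.unop⟩

lemma ses_of_mono {A B : C} (i : A ⟶ B) [Mono i] : Ses i (cokernel.π i) :=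
  ⟨cokernel.condition i, ShortComplex.ShortExact.mk'
    (ShortComplex.exact_of_g_is_cokernel _ (cokernelIsCokernel i)) ‹_› inferInstance⟩

lemma ses_of_epi {A B : C} (p : A ⟶ B) [Epi p] : Ses (kernel.ι p) p :=
  ⟨kernel.condition p, ShortComplex.ShortExact.mk'
    (ShortComplex.exact_of_f_is_kernel _ (kernelIsKernel p)) inferInstance ‹_›⟩

lemma ses_biprod (A B : C) : Ses (biprod.inl : A ⟶ A ⊞ B) (biprod.snd : A ⊞ B ⟶ B) :=
  ⟨by simp, (ShortComplex.Splitting.ofHasBinaryBiproduct A B).shortExact⟩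

lemma ses_biprod' (A B : C) : Ses (biprod.inr : B ⟶ A ⊞ B) (biprod.fst : A ⊞ B ⟶ A) := by
  have h : (ShortComplex.mk (biprod.inr : B ⟶ A ⊞ B) biprod.fst (by simp)).Splitting :=
    { r := biprod.snd, s := biprod.inl, id := by simp [add_comm] }
  exact ⟨by simp, h.shortExact⟩

lemma ses_id_left (A : C) : Ses (𝟙 A) (0 : A ⟶ (0 : C)) := by
  have h : (ShortComplex.mk (𝟙 A) (0 : A ⟶ (0 : C)) (by simp)).Splitting :=
    { r := 𝟙 A, s := 0, s_g := by ext }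
  exact ⟨by simp, h.shortExact⟩

lemma ses_id_right (A : C) : Ses (0 : (0 : C) ⟶ A) (𝟙 A) := by
  have h : (ShortComplex.mk (0 : (0 : C) ⟶ A) (𝟙 A) (by simp)).Splitting :=
    { r := 0, s := 𝟙 A, f_r := by ext }
  exact ⟨by simp, h.shortExact⟩

lemma three {A B D I P J A' B' D' : C} {i : A ⟶ B} {p : B ⟶ D} (h : Ses i p)
    {u : I ⟶ P} {v : P ⟶ J} (hu : Ses u v) {a : A ⟶ I} {a' : I ⟶ A'} (ha : Ses a a')
    {c : D ⟶ J} {c' : J ⟶ D'} (hc : Ses c c') {b : B ⟶ P} {b' : P ⟶ B'} (hb : Ses b b')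
    (e₁ : i ≫ b = a ≫ u) (e₂ : b ≫ v = p ≫ c) :
    ∃ (x : A' ⟶ B') (y : B' ⟶ D'), Ses x y := by
  obtain ⟨w, h⟩ := h
  obtain ⟨wu, hu⟩ := hu
  obtain ⟨wa, ha⟩ := ha
  obtain ⟨wb, hb⟩ := hb
  obtain ⟨wc, hc⟩ := hc
  have := h.mono_f; have := h.epi_g; have := hu.mono_f; have := hu.epi_g
  have := ha.mono_f; have := ha.epi_g; have := hb.mono_f; have := hb.epi_g
  have := hc.mono_f; have := hc.epi_g
  dsimp at *
  obtain ⟨x, hx⟩ : ∃ x : A' ⟶ B', a' ≫ x = u ≫ b' :=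
    ⟨ha.exact.desc (u ≫ b') (by dsimp; rw [← Category.assoc, ← e₁, Category.assoc, wb, comp_zero]),
      ha.exact.g_desc _ _⟩
  obtain ⟨y, hy⟩ : ∃ y : B' ⟶ D', b' ≫ y = v ≫ c' :=
    ⟨hb.exact.desc (v ≫ c') (by dsimp; rw [← Category.assoc, e₂, Category.assoc, wc, comp_zero]),
      hb.exact.g_desc _ _⟩
  have hxy : x ≫ y = 0 := by
    rw [← cancel_epi a', reassoc_of% hx, hy, reassoc_of% wu, comp_zero, zero_comp]
  let S : ShortComplex.SnakeInput C :=
    { L₀ := ShortComplex.mk (0 : (0 : C) ⟶ 0) (0 : (0 : C) ⟶ 0) (by simp)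
      L₁ := ShortComplex.mk i p w
      L₂ := ShortComplex.mk u v wu
      L₃ := ShortComplex.mk x y hxy
      v₀₁ := 0
      v₁₂ := { τ₁ := a, τ₂ := b, τ₃ := c, comm₁₂ := e₁.symm, comm₂₃ := e₂ }
      v₂₃ := { τ₁ := a', τ₂ := b', τ₃ := c', comm₁₂ := hx, comm₂₃ := hy }
      w₀₂ := by simp
      w₁₃ := by ext <;> assumption
      h₀ := by
        apply ShortComplex.isLimitOfIsLimitπ <;>
          apply (KernelFork.isLimitMapConeEquiv _ _).2
        · exact KernelFork.IsLimit.ofMonoOfIsZero _ (inferInstanceAs (Mono a)) (isZero_zero _)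
        · exact KernelFork.IsLimit.ofMonoOfIsZero _ (inferInstanceAs (Mono b)) (isZero_zero _)
        · exact KernelFork.IsLimit.ofMonoOfIsZero _ (inferInstanceAs (Mono c)) (isZero_zero _)
      h₃ := by
        apply ShortComplex.isColimitOfIsColimitπ <;>
          apply (CokernelCofork.isColimitMapCoconeEquiv _ _).2
        · exact ha.gIsCokernel
        · exact hb.gIsCokernel
        · exact hc.gIsCokernel
      L₁_exact := h.exact
      epi_L₁_g := h.epi_g
      L₂_exact := hu.exact
      mono_L₂_f := hu.mono_f }
  refine ⟨x, y, hxy, ShortComplex.ShortExact.mk' S.L₃_exact ?_ ?_⟩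
  · have h0 : S.L₂'.f = 0 := (isZero_zero C).eq_of_src _ _
    exact S.L₂'_exact.mono_g h0
  · have : Epi S.L₂.g := hu.epi_g
    exact S.epi_L₃_g

lemma three' {A B D I P J A' B' D' : C} {i : A ⟶ B} {p : B ⟶ D} (h : Ses i p)
    {u : I ⟶ P} {v : P ⟶ J} (hu : Ses u v) {a : A' ⟶ I} {a' : I ⟶ A} (ha : Ses a a')
    {c : D' ⟶ J} {c' : J ⟶ D} (hc : Ses c c') {b : B' ⟶ P} {b' : P ⟶ B} (hb : Ses b b')
    (e₁ : u ≫ b' = a' ≫ i) (e₂ : b' ≫ p = v ≫ c') :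
    ∃ (x : A' ⟶ B') (y : B' ⟶ D'), Ses x y := by
  obtain ⟨x, y, hxy⟩ := three h.op hu.op hc.op ha.op hb.op
    (by rw [← op_comp, e₂, op_comp]) (by rw [← op_comp, e₁, op_comp])
  exact ⟨y.unop, x.unop, hxy.unop⟩

lemma comp_coker {X Y Z Q₁ Q₂ : C} {f : X ⟶ Y} {f' : Y ⟶ Q₁} (hf : Ses f f')
    {g : Y ⟶ Z} {g' : Z ⟶ Q₂} (hg : Ses g g') :
    ∃ (Q : C) (h : Z ⟶ Q) (x : Q₁ ⟶ Q) (y : Q ⟶ Q₂), Ses (f ≫ g) h ∧ Ses x y := by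
  have := hf.mono
  have := hg.mono
  have h := ses_of_mono (f ≫ g)
  obtain ⟨x, y, hxy⟩ := three (ses_id_left X) hg hf (ses_id_right Q₂) h (by simp)
    (by rw [Category.assoc, hg.1, comp_zero, comp_zero])
  exact ⟨_, _, x, y, h, hxy⟩

lemma pushout_ses {K G M D X : C} {k : K ⟶ G} {p : G ⟶ M} (hk : Ses k p)
    {d : K ⟶ D} {q : D ⟶ X} (hd : Ses d q) :
    ∃ (Y : C) (g : G ⟶ Y) (g' : Y ⟶ X) (e : D ⟶ Y) (e' : Y ⟶ M), Ses g g' ∧ Ses e e' := by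
  have := hk.mono
  have : Mono (biprod.lift d k) := mono_of_mono_fac (biprod.lift_snd d k)
  have h := ses_of_mono (biprod.lift d k)
  obtain ⟨x, y, hxy⟩ := three (ses_id_right K) (ses_biprod D G) (ses_id_right D) hk h
    (by simp) (by simp)
  obtain ⟨x', y', hxy'⟩ := three (ses_id_right K) (ses_biprod' D G) (ses_id_right G) hd h
    (by simp) (by simp)
  exact ⟨_, x', y', x, y, hxy', hxy⟩

/-- One step of a complete projective resolution. -/
def GStep (Y Y' : C) : Prop :=
  ∃ (P : C) (i : Y ⟶ P) (p : P ⟶ Y'), Ses i p ∧ Projective P ∧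
    ∀ Q : C, Projective Q → ∀ f : Y ⟶ Q, ∃ g : P ⟶ Q, i ≫ g = f

/-- Gorenstein projective objects, coinductively. -/
def GP (X : C) : Prop :=
  ∃ T : C → Prop, T X ∧ ∀ Y, T Y → (∃ Y', T Y' ∧ GStep Y Y') ∧ (∃ Y', T Y' ∧ GStep Y' Y)

/-- Gorenstein projective dimension at most `n`. -/
def LR : ℕ → C → Prop
  | 0, M => GP M
  | n + 1, M => ∃ (K G : C) (i : K ⟶ G) (p : G ⟶ M), Ses i p ∧ GP G ∧ LR n K

lemma gp_of_projective (X : C) (hX : Projective X) : GP X := by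
  refine ⟨fun Y => Projective Y, hX, fun Y hY => ⟨⟨0, inferInstance, Y, 𝟙 Y, 0, ses_id_left Y, hY,
    fun Q _ f => ⟨f, by simp⟩⟩, ⟨0, inferInstance, Y, 0, 𝟙 Y, ses_id_right Y, hY,
    fun Q _ f => ⟨0, (isZero_zero C).eq_of_src _ _⟩⟩⟩⟩

section ExtLemmas

variable [HasExt.{w} C]

lemma ext_sub₃ {A B D Q : C} {i : A ⟶ B} {p : B ⟶ D} (h : Ses i p) (k : ℕ)
    (hA : Subsingleton (Ext.{w} A Q k)) (hB : Subsingleton (Ext.{w} B Q (k + 1))) :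
    Subsingleton (Ext.{w} D Q (k + 1)) := by
  refine subsingleton_of_forall_eq 0 fun x => ?_
  obtain ⟨w, h⟩ := h
  obtain ⟨y, rfl⟩ := Ext.contravariant_sequence_exact₃ h Q x (Subsingleton.elim (α := Ext B Q (k+1)) _ _)
    (add_comm 1 k)
  rw [show y = 0 from Subsingleton.elim (α := Ext A Q k) _ _, Ext.comp_zero]

lemma ext_sub₂ {A B D Q : C} {i : A ⟶ B} {p : B ⟶ D} (h : Ses i p) (k : ℕ)
    (hA : Subsingleton (Ext.{w} A Q k)) (hD : Subsingleton (Ext.{w} D Q k)) :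
    Subsingleton (Ext.{w} B Q k) := by
  refine subsingleton_of_forall_eq 0 fun x => ?_
  obtain ⟨w, h⟩ := h
  obtain ⟨y, rfl⟩ := Ext.contravariant_sequence_exact₂ h Q x (Subsingleton.elim (α := Ext A Q k) _ _)
  rw [show y = 0 from Subsingleton.elim (α := Ext D Q k) _ _, Ext.comp_zero]

lemma ext_sub₁ {A B D Q : C} {i : A ⟶ B} {p : B ⟶ D} (h : Ses i p) (k : ℕ)
    (hB : Subsingleton (Ext.{w} B Q k)) (hD : Subsingleton (Ext.{w} D Q (k + 1))) :
    Subsingleton (Ext.{w} A Q k) := by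
  refine subsingleton_of_forall_eq 0 fun x => ?_
  obtain ⟨w, h⟩ := h
  obtain ⟨y, rfl⟩ := Ext.contravariant_sequence_exact₁ h Q x (add_comm 1 k)
    (Subsingleton.elim (α := Ext D Q (k+1)) _ _)
  rw [show y = 0 from Subsingleton.elim (α := Ext B Q k) _ _, Ext.comp_zero]

lemma ext_proj (P Q : C) (hP : Projective P) (k : ℕ) : Subsingleton (Ext.{w} P Q (k + 1)) :=
  Ext.subsingleton_of_projective P Q k

lemma extend {A B D Q : C} {i : A ⟶ B} {p : B ⟶ D} (h : Ses i p)
    (hD : Subsingleton (Ext.{w} D Q 1)) (f : A ⟶ Q) : ∃ g : B ⟶ Q, i ≫ g = f := by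
  obtain ⟨w, h⟩ := h
  obtain ⟨y, hy⟩ := Ext.contravariant_sequence_exact₁ h Q (Ext.mk₀ f) (add_zero 1)
    (Subsingleton.elim (α := Ext D Q 1) _ _)
  obtain ⟨g, rfl⟩ := (Ext.mk₀_bijective _ _).2 y
  rw [Ext.mk₀_comp_mk₀] at hy
  exact ⟨g, (Ext.mk₀_bijective _ _).1 hy⟩

lemma ext_one_of_extend {A B D Q : C} {i : A ⟶ B} {p : B ⟶ D} (h : Ses i p)
    (hB : Subsingleton (Ext.{w} B Q 1)) (hf : ∀ f : A ⟶ Q, ∃ g : B ⟶ Q, i ≫ g = f) :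
    Subsingleton (Ext.{w} D Q 1) := by
  refine subsingleton_of_forall_eq 0 fun x => ?_
  obtain ⟨w, h⟩ := h
  obtain ⟨y, rfl⟩ := Ext.contravariant_sequence_exact₃ h Q x (Subsingleton.elim (α := Ext B Q 1) _ _)
    (add_zero 1)
  obtain ⟨f, rfl⟩ := (Ext.mk₀_bijective _ _).2 y
  obtain ⟨g, rfl⟩ := hf f
  rw [← Ext.mk₀_comp_mk₀]
  exact h.extClass_comp_assoc _

lemma gp_ext {Q : C} (hQ : Projective Q) (k : ℕ) (X : C) (hX : GP X) :
    Subsingleton (Ext.{w} X Q (k + 1)) := by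
  obtain ⟨T, hTX, hT⟩ := hX
  induction k generalizing X with
  | zero =>
    obtain ⟨Y', _, P, i, p, h, hP, hf⟩ := (hT X hTX).2
    exact ext_one_of_extend h (ext_proj P Q hP 0) (hf Q hQ)
  | succ k ih =>
    obtain ⟨Y', hY', P, i, p, h, hP, hf⟩ := (hT X hTX).2
    exact ext_sub₃ h (k + 1) (ih Y' hY') (ext_proj P Q hP (k + 1))

lemma lr_ext {Q : C} (hQ : Projective Q) (n : ℕ) (M : C) (hM : LR n M) (k : ℕ) :
    Subsingleton (Ext.{w} M Q (n + k + 1)) := by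
  induction n generalizing M with
  | zero => rw [zero_add]; exact gp_ext hQ k M hM
  | succ n ih =>
    obtain ⟨K, G, i, p, h, hG, hK⟩ := hM
    have := ext_sub₃ h (n + k + 1) (ih K hK) (gp_ext hQ (n + k + 1) G hG)
    rwa [show n + 1 + k + 1 = n + k + 1 + 1 by ring]

/-- Extension closure of the Gorenstein projectives. -/
inductive V : C → Prop
  | gp (X : C) : GP X → V X
  | ext {A B D : C} (i : A ⟶ B) (p : B ⟶ D) : Ses i p → V A → V D → V B

lemma v_ext {Q : C} (hQ : Projective Q) (X : C) (hX : V X) : Subsingleton (Ext.{w} X Q 1) := by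
  induction hX with
  | gp X h => exact gp_ext hQ 0 X h
  | ext i p h _ _ hA hD => exact ext_sub₂ h 1 hA hD

lemma v_embed (X : C) (hX : V X) :
    ∃ (P X' : C) (i : X ⟶ P) (p : P ⟶ X'), Ses i p ∧ Projective P ∧ V X' := by
  induction hX with
  | gp X h =>
    obtain ⟨T, hTX, hT⟩ := h
    obtain ⟨Y', hY', P, i, p, h, hP, -⟩ := (hT X hTX).1
    exact ⟨P, Y', i, p, h, hP, V.gp _ ⟨T, hY', hT⟩⟩
  | @ext A B D i p h hVA hVD hA hD =>
    obtain ⟨I, A', a, a', ha, hI, hA'⟩ := hA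
    obtain ⟨J, D', c, c', hc, hJ, hD'⟩ := hD
    obtain ⟨e, he⟩ := extend h (v_ext hI D hVD) a
    have e₁ : i ≫ biprod.lift e (p ≫ c) = a ≫ (biprod.inl : I ⟶ I ⊞ J) := by
      ext
      · simp [he]
      · simp [reassoc_of% h.1]
    have e₂ : biprod.lift e (p ≫ c) ≫ (biprod.snd : I ⊞ J ⟶ J) = p ≫ c := by simp
    have : Mono (biprod.lift e (p ≫ c)) := by
      have := ha.mono; have := hc.mono; have := h.mono
      exact ShortComplex.mono_τ₂_of_exact_of_mono
        (S₁ := ShortComplex.mk i p h.1) (S₂ := ShortComplex.mk (biprod.inl : I ⟶ I ⊞ J) biprod.snd (by simp))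
        { τ₁ := a, τ₂ := biprod.lift e (p ≫ c), τ₃ := c, comm₁₂ := e₁.symm, comm₂₃ := e₂ }
        h.2.exact
    have hb := ses_of_mono (biprod.lift e (p ≫ c))
    obtain ⟨x, y, hxy⟩ := three h (ses_biprod I J) ha hc hb e₁ e₂
    exact ⟨_, _, _, _, hb, inferInstance, V.ext x y hxy hA' hD'⟩

lemma lr_embed (n : ℕ) (M : C) (hM : LR n M) :
    ∃ (D X : C) (i : M ⟶ D) (p : D ⟶ X), Ses i p ∧ HasProjectiveDimensionLT D (n + 1) ∧ V X := by
  induction n generalizing M with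
  | zero =>
    obtain ⟨P, X', i, p, h, hP, hV⟩ := v_embed M (V.gp M hM)
    exact ⟨P, X', i, p, h, inferInstance, hV⟩
  | succ n ih =>
    obtain ⟨K, G, k, p, h, hG, hK⟩ := hM
    obtain ⟨D, X, d, q, hd, hD, hX⟩ := ih K hK
    obtain ⟨Y, g, g', e, e', hg, he⟩ := pushout_ses h hd
    obtain ⟨P, Y', j, r, hj, hP, hY'⟩ := v_embed Y (V.ext g g' hg (V.gp G hG) hX)
    obtain ⟨D', s, x, y, hs, hxy⟩ := comp_coker he hj
    refine ⟨D', Y', x, y, hxy, ?_, hY'⟩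
    exact hs.2.hasProjectiveDimensionLT_X₃ (n + 1) hD (hasProjectiveDimensionLT_of_ge P 1 _ (by omega))

/-- `X` is an `n`-th syzygy of `M`. -/
def Syz : ℕ → C → C → Prop
  | 0, M, X => M = X
  | n + 1, M, X => ∃ (K P : C) (i : K ⟶ P) (p : P ⟶ M), Ses i p ∧ Projective P ∧ Syz n K X

lemma syz_exists [EnoughProjectives C] (n : ℕ) (M : C) : ∃ X, Syz n M X := by
  induction n generalizing M with
  | zero => exact ⟨M, rfl⟩
  | succ n ih =>
    obtain ⟨X, hX⟩ := ih (kernel (Projective.π M))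
    exact ⟨X, _, _, _, _, ses_of_epi (Projective.π M), inferInstance, hX⟩

lemma syz_ext {Q : C} (n : ℕ) (M X : C) (h : Syz n M X) (k : ℕ)
    (hM : Subsingleton (Ext.{w} M Q (n + k + 1))) : Subsingleton (Ext.{w} X Q (k + 1)) := by
  induction n generalizing M with
  | zero => cases h; simpa using hM
  | succ n ih =>
    obtain ⟨K, P, i, p, h, hP, hK⟩ := h
    refine ih K hK (ext_sub₁ h _ (ext_proj P Q hP _) ?_)
    rwa [show n + k + 1 + 1 = n + 1 + k + 1 by ring]

lemma syz_pd (n : ℕ) (M X : C) (h : Syz n M X)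
    (hM : HasProjectiveDimensionLT M (n + 1)) : Projective X := by
  induction n generalizing M with
  | zero => cases h; exact projective_iff_hasProjectiveDimensionLT_one |>.2 hM
  | succ n ih =>
    obtain ⟨K, P, i, p, h, hP, hK⟩ := h
    exact ih K hK ((h.2.hasProjectiveDimensionLT_X₃_iff n hP).1 hM)

lemma syz_horseshoe (n : ℕ) {A B D X Z : C} {i : A ⟶ B} {p : B ⟶ D} (h : Ses i p)
    (hX : Syz n A X) (hZ : Syz n D Z) :
    ∃ (Y : C) (x : X ⟶ Y) (y : Y ⟶ Z), Syz n B Y ∧ Ses x y := by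
  induction n generalizing A B D with
  | zero => cases hX; cases hZ; exact ⟨B, i, p, rfl, h⟩
  | succ n ih =>
    obtain ⟨KA, I, a, a', ha, hI, hX⟩ := hX
    obtain ⟨KD, J, c, c', hc, hJ, hZ⟩ := hZ
    have := h.epi
    let e : J ⟶ B := Projective.factorThru c' p
    have he : e ≫ p = c' := Projective.factorThru_comp c' p
    have e₁ : (biprod.inl : I ⟶ I ⊞ J) ≫ biprod.desc (a' ≫ i) e = a' ≫ i := by simp
    have e₂ : biprod.desc (a' ≫ i) e ≫ p = (biprod.snd : I ⊞ J ⟶ J) ≫ c' := by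
      ext
      · simp [h.1]
      · simp [he]
    have : Epi (biprod.desc (a' ≫ i) e) := by
      have := ha.epi; have := hc.epi
      exact ShortComplex.epi_τ₂_of_exact_of_epi
        (S₂ := ShortComplex.mk i p h.1) (S₁ := ShortComplex.mk (biprod.inl : I ⟶ I ⊞ J) biprod.snd (by simp))
        { τ₁ := a', τ₂ := biprod.desc (a' ≫ i) e, τ₃ := c', comm₁₂ := e₁.symm, comm₂₃ := e₂ }
        h.2.exact
    have hb := ses_of_epi (biprod.desc (a' ≫ i) e)
    obtain ⟨x, y, hxy⟩ := three' h (ses_biprod I J) ha hc hb e₁ e₂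
    obtain ⟨Y, x', y', hY, hxy'⟩ := ih hxy hX hZ
    exact ⟨Y, x', y', ⟨_, _, _, _, hb, inferInstance, hY⟩, hxy'⟩

lemma syz_succ (n : ℕ) {M X K P : C} (hX : Syz n M X) {i : K ⟶ P} {p : P ⟶ X} (h : Ses i p)
    (hP : Projective P) : Syz (n + 1) M K := by
  induction n generalizing M with
  | zero => cases hX; exact ⟨K, P, i, p, h, hP, rfl⟩
  | succ n ih =>
    obtain ⟨K', P', i', p', h', hP', hX⟩ := hX
    exact ⟨K', P', i', p', h', hP', ih hX⟩

lemma lr_of_syz (n : ℕ) (M X : C) (h : Syz n M X) (hX : GP X) : LR n M := by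
  induction n generalizing M with
  | zero => cases h; exact hX
  | succ n ih =>
    obtain ⟨K, P, i, p, h, hP, hK⟩ := h
    exact ⟨K, P, i, p, h, gp_of_projective P hP, ih K hK⟩

lemma gp_of_syz [EnoughProjectives C] [EnoughInjectives C] (n : ℕ)
    (h₁ : ∀ E : C, Injective E → HasProjectiveDimensionLT E (n + 1))
    (h₂ : ∀ Q : C, Projective Q → HasInjectiveDimensionLT Q (n + 1)) (M X : C) (h : Syz n M X) :
    GP X := by
  have key : ∀ (M X Q : C), Syz n M X → Projective Q → Subsingleton (Ext.{w} X Q 1) := by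
    intro M X Q h hQ
    have := h₂ Q hQ
    exact syz_ext n M X h 0 (HasInjectiveDimensionLT.subsingleton Q (n + 1) _ (by omega) M)
  refine ⟨fun X => ∃ M, Syz n M X, ⟨M, h⟩, ?_⟩
  clear h X M
  rintro X ⟨M, h⟩
  constructor
  · have hs := ses_of_mono (Injective.ι M)
    obtain ⟨Z, hZ⟩ := syz_exists n (cokernel (Injective.ι M))
    obtain ⟨Y, x, y, hY, hxy⟩ := syz_horseshoe n hs h hZ
    exact ⟨Z, ⟨_, hZ⟩, Y, x, y, hxy, syz_pd n _ Y hY (h₁ _ inferInstance),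
      fun Q hQ f => extend hxy (key _ _ _ hZ hQ) f⟩
  · have hs := ses_of_epi (Projective.π X)
    obtain ⟨K, P, i, p, _, _, hK⟩ := syz_succ n h hs inferInstance
    exact ⟨_, ⟨_, hK⟩, _, _, _, hs, inferInstance, fun Q hQ f => extend hs (key _ _ _ h hQ) f⟩

end ExtLemmas

theorem main_iff [EnoughProjectives C] [EnoughInjectives C] (n : ℕ) :
    (∀ M : C, LR n M) ↔ (∀ E : C, Injective E → HasProjectiveDimensionLT E (n + 1)) ∧
      (∀ Q : C, Projective Q → HasInjectiveDimensionLT Q (n + 1)) := by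
  letI := HasExt.standard C
  constructor
  · intro h
    constructor
    · intro E hE
      obtain ⟨D, X, i, p, hi, hD, -⟩ := lr_embed n E (h E)
      have := hi.mono
      exact Retract.hasProjectiveDimensionLT
        { i := i, r := Injective.factorThru (𝟙 E) i, retract := Injective.comp_factorThru _ _ } (n + 1)
    · intro Q hQ
      refine HasInjectiveDimensionLT.mk fun i hi Y e => ?_
      obtain ⟨k, rfl⟩ := Nat.exists_eq_add_of_le hi
      have := lr_ext hQ n Y (h Y) k
      rw [show n + k + 1 = n + 1 + k by ring] at this
      exact Subsingleton.elim _ _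
  · rintro ⟨h₁, h₂⟩ M
    obtain ⟨X, hX⟩ := syz_exists n M
    exact lr_of_syz n M X hX (gp_of_syz n h₁ h₂ M X hX)

lemma pd_op [EnoughProjectives C] (n : ℕ) (X : C) :
    HasProjectiveDimensionLT X (n + 1) ↔ HasInjectiveDimensionLT (op X) (n + 1) := by
  induction n generalizing X with
  | zero =>
    rw [zero_add, ← projective_iff_hasProjectiveDimensionLT_one,
      ← injective_iff_hasInjectiveDimensionLT_one, Injective.projective_iff_injective_op]
  | succ n ih =>
    have h := ses_of_epi (Projective.π X)
    have h1 := h.2.hasProjectiveDimensionLT_X₃_iff n (inferInstanceAs (Projective (Projective.over X)))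
    have h2 := h.op.2.hasInjectiveDimensionLT_X₃_iff n
      (inferInstanceAs (Injective (op (Projective.over X))))
    exact h1.trans ((ih _).trans h2)

lemma id_op [EnoughInjectives C] (n : ℕ) (X : C) :
    HasInjectiveDimensionLT X (n + 1) ↔ HasProjectiveDimensionLT (op X) (n + 1) := by
  induction n generalizing X with
  | zero =>
    rw [zero_add, ← projective_iff_hasProjectiveDimensionLT_one,
      ← injective_iff_hasInjectiveDimensionLT_one, Injective.injective_iff_projective_op]
  | succ n ih =>
    have h := ses_of_mono (Injective.ι X)
    have h1 := h.2.hasInjectiveDimensionLT_X₃_iff n (inferInstanceAs (Injective (Injective.under X)))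
    have h2 := h.op.2.hasProjectiveDimensionLT_X₃_iff n
      (inferInstanceAs (Projective (op (Injective.under X))))
    exact h1.symm.trans ((ih _).trans h2.symm)

theorem main_op [EnoughProjectives C] [EnoughInjectives C] (n : ℕ) :
    (∀ M : C, LR n M) ↔ (∀ M : C, LR n (op M)) := by
  rw [main_iff]
  have : (∀ M : C, LR n (op M)) ↔ ∀ M : Cᵒᵖ, LR n M :=
    ⟨fun h M => h M.unop, fun h M => h (op M)⟩
  rw [this, main_iff, and_comm]
  refine and_congr ⟨fun h E hE => ?_, fun h Q hQ => ?_⟩ ⟨fun h E hE => ?_, fun h Q hQ => ?_⟩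
  · exact (id_op n E.unop).1 (h _ (Injective.projective_iff_injective_op.2 hE))
  · exact (id_op n Q).2 (h _ (Injective.projective_iff_injective_op.1 hQ))
  · exact (pd_op n E.unop).1 (h _ (Injective.injective_iff_projective_op.2 hE))
  · exact (pd_op n Q).2 (h _ (Injective.injective_iff_projective_op.1 hQ))

end Abstract

end GorAux

namespace GorAux

open CategoryTheory Opposite

section Concrete

variable {R : Type u} [Ring R]

lemma ses_of {A B D : Type u} [AddCommGroup A] [Module R A] [AddCommGroup B] [Module R B]
    [AddCommGroup D] [Module R D] (f : A →ₗ[R] B) (g : B →ₗ[R] D) (hf : Function.Injective f)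
    (hfg : Function.Exact f g) (hg : Function.Surjective g) :
    Ses (ModuleCat.ofHom f) (ModuleCat.ofHom g) := by
  refine ⟨by ext x; exact hfg.apply_apply_eq_zero x, ShortComplex.ShortExact.mk' ?_ ?_ ?_⟩
  · rw [ShortComplex.ShortExact.moduleCat_exact_iff_function_exact]; exact hfg
  · exact (ModuleCat.mono_iff_injective _).2 hf
  · exact (ModuleCat.epi_iff_surjective _).2 hg

lemma ses_elim {A B D : ModuleCat.{u} R} {f : A ⟶ B} {g : B ⟶ D} (h : Ses f g) :
    Function.Injective f.hom ∧ Function.Exact f.hom g.hom ∧ Function.Surjective g.hom := by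
  have h1 := h.2.exact
  rw [ShortComplex.ShortExact.moduleCat_exact_iff_function_exact] at h1
  exact ⟨(ModuleCat.mono_iff_injective _).1 h.mono, h1, (ModuleCat.epi_iff_surjective _).1 h.epi⟩

lemma gstep_op_iff (A A' : ModuleCat.{u} R) : GStep (op A) (op A') ↔
    ∃ (I : ModuleCat.{u} R) (i : A' ⟶ I) (p : I ⟶ A), Ses i p ∧ Injective I ∧
      ∀ E : ModuleCat.{u} R, Injective E → ∀ f : E ⟶ A, ∃ g : E ⟶ I, g ≫ p = f := by
  constructor
  · rintro ⟨P, i, p, h, hP, hf⟩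
    refine ⟨P.unop, p.unop, i.unop, h.unop, Injective.injective_iff_projective_op.2 hP, ?_⟩
    intro E hE f
    obtain ⟨g, hg⟩ := hf (op E) (Injective.injective_iff_projective_op.1 hE) f.op
    exact ⟨g.unop, by rw [← unop_comp, hg]; rfl⟩
  · rintro ⟨I, i, p, h, hI, hf⟩
    refine ⟨op I, p.op, i.op, h.op, Injective.injective_iff_projective_op.1 hI, ?_⟩
    intro Q hQ f
    obtain ⟨g, hg⟩ := hf Q.unop (Injective.injective_iff_projective_op.2 hQ) f.unop
    exact ⟨g.op, by rw [← op_comp, hg]; rfl⟩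

lemma int_chain {α : Type*} (r : α → α → Prop) (T : α → Prop)
    (hT : ∀ x, T x → (∃ y, T y ∧ r x y) ∧ (∃ y, T y ∧ r y x)) (x : α) (hx : T x) :
    ∃ f : ℤ → α, f 0 = x ∧ ∀ i, r (f i) (f (i + 1)) := by
  choose nx hnx using fun y : {y // T y} => (hT y.1 y.2).1
  choose pv hpv using fun y : {y // T y} => (hT y.1 y.2).2
  let N : {y // T y} → {y // T y} := fun y => ⟨nx y, (hnx y).1⟩
  let Q : {y // T y} → {y // T y} := fun y => ⟨pv y, (hpv y).1⟩
  let f : ℤ → {y // T y} := fun i => match i with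
    | Int.ofNat n => N^[n] ⟨x, hx⟩
    | Int.negSucc n => Q^[n + 1] ⟨x, hx⟩
  refine ⟨fun i => (f i).1, rfl, ?_⟩
  intro i
  rcases i with n | n
  · have : f (Int.ofNat n + 1) = N (f (Int.ofNat n)) := by
      change N^[n + 1] _ = N (N^[n] _)
      rw [Function.iterate_succ_apply']
    dsimp only
    rw [this]
    exact (hnx _).2
  · have : f (Int.negSucc n) = Q (f (Int.negSucc n + 1)) := by
      rcases n with _ | n
      · rfl
      · change Q^[n + 1 + 1] _ = Q (Q^[n + 1] _)
        rw [Function.iterate_succ_apply']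
    dsimp only
    rw [this]
    exact (hpv _).2

lemma exact_sub {A B D : Type u} [AddCommGroup A] [Module R A] [AddCommGroup B] [Module R B]
    [AddCommGroup D] [Module R D] {f : A →ₗ[R] B} {g : B →ₗ[R] D} (hfg : Function.Exact f g)
    {Y Y' : Type u} [AddCommGroup Y] [Module R Y] [AddCommGroup Y'] [Module R Y']
    (e : Y ≃ₗ[R] LinearMap.ker f) (e' : Y' ≃ₗ[R] LinearMap.ker g) :
    ∃ (i : Y →ₗ[R] A) (p : A →ₗ[R] Y'), Ses (ModuleCat.ofHom i) (ModuleCat.ofHom p) ∧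
      (∀ y, i y = (e y : A)) ∧ (∀ a, (e' (p a) : B) = f a) := by
  refine ⟨(LinearMap.ker f).subtype ∘ₗ e.toLinearMap,
    e'.symm.toLinearMap ∘ₗ f.codRestrict (LinearMap.ker g) hfg.apply_apply_eq_zero, ?_, ?_, ?_⟩
  · apply ses_of
    · intro x y h
      exact e.injective (Subtype.ext h)
    · intro a
      simp only [LinearMap.comp_apply, LinearEquiv.coe_coe, LinearEquiv.map_eq_zero_iff]
      constructor
      · intro h
        have h' : f a = 0 := congrArg Subtype.val h
        exact ⟨e.symm ⟨a, h'⟩, by simp⟩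
      · rintro ⟨y, rfl⟩
        exact Subtype.ext (e y).2
    · intro y
      obtain ⟨a, ha⟩ := (hfg (e' y)).1 (e' y).2
      refine ⟨a, ?_⟩
      rw [LinearMap.comp_apply, LinearEquiv.coe_coe, LinearEquiv.symm_apply_eq]
      exact Subtype.ext ha
  · intro y; rfl
  · intro a
    simp only [LinearMap.comp_apply, LinearEquiv.coe_coe, LinearEquiv.apply_symm_apply]
    rfl

lemma gp_of_concrete {M : Type u} [AddCommGroup M] [Module R M] (h : GorensteinProjective R M) :
    GP (ModuleCat.of R M) := by
  obtain ⟨P, _, _, d, hP, hd, ⟨e⟩, hQ⟩ := h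
  have key : ∀ (i : ℤ) (Y Y' : ModuleCat.{u} R) (e : Y ≃ₗ[R] LinearMap.ker (d i))
      (e' : Y' ≃ₗ[R] LinearMap.ker (d (i + 1))), GStep Y Y' := by
    intro i Y Y' e e'
    obtain ⟨j, rfl⟩ : ∃ j, i = j + 1 + 1 := ⟨i - 2, by ring⟩
    obtain ⟨ι, p, hs, hι, hp⟩ := exact_sub (hd _) e e'
    refine ⟨ModuleCat.of R (P (j + 1 + 1)), ModuleCat.ofHom ι, ModuleCat.ofHom p, hs,
      (IsProjective.iff_projective _).1 (hP _), ?_⟩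
    intro Q hQ' f
    have hQ'' : Module.Projective R Q := (IsProjective.iff_projective _).2 hQ'
    let g : P (j + 1) →ₗ[R] Q := f.hom ∘ₗ e.symm.toLinearMap ∘ₗ
      (d (j + 1)).codRestrict (LinearMap.ker (d (j + 1 + 1))) (hd (j + 1)).apply_apply_eq_zero
    have hg : g ∘ₗ d j = 0 := by
      ext x
      have : (d (j + 1)).codRestrict (LinearMap.ker (d (j + 1 + 1)))
          (hd (j + 1)).apply_apply_eq_zero (d j x) = 0 :=
        Subtype.ext ((hd j).apply_apply_eq_zero x)
      simp only [g, LinearMap.comp_apply, this, map_zero, LinearMap.zero_apply]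
    obtain ⟨k, hk⟩ := (hQ Q _ _ hQ'' j g).1 hg
    refine ⟨ModuleCat.ofHom k, ?_⟩
    ext y
    obtain ⟨a, ha⟩ := (hd (j + 1) (e y)).1 (e y).2
    have h1 := LinearMap.congr_fun hk a
    have h2 : (d (j + 1)).codRestrict (LinearMap.ker (d (j + 1 + 1)))
          (hd (j + 1)).apply_apply_eq_zero a = e y := Subtype.ext ha
    simp only [g, LinearMap.comp_apply, h2, LinearEquiv.coe_coe, LinearEquiv.symm_apply_apply,
      ha] at h1
    change k (ι y) = f.hom y
    rw [hι, h1]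
  refine ⟨fun Y => ∃ j, Nonempty (Y ≃ₗ[R] LinearMap.ker (d j)), ⟨0, ⟨e⟩⟩, ?_⟩
  rintro Y ⟨j, ⟨e⟩⟩
  constructor
  · exact ⟨ModuleCat.of R (LinearMap.ker (d (j + 1))), ⟨j + 1, ⟨LinearEquiv.refl R _⟩⟩,
      key j _ _ e (LinearEquiv.refl R _)⟩
  · obtain ⟨i, rfl⟩ : ∃ i, j = i + 1 := ⟨j - 1, by ring⟩
    exact ⟨ModuleCat.of R (LinearMap.ker (d i)), ⟨i, ⟨LinearEquiv.refl R _⟩⟩,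
      key i _ _ (LinearEquiv.refl R _) e⟩

lemma gi_of_concrete {M : Type u} [AddCommGroup M] [Module R M] (h : GorensteinInjective R M) :
    GP (op (ModuleCat.of R M)) := by
  obtain ⟨I, _, _, d, hI, hd, ⟨e⟩, hE⟩ := h
  have key : ∀ (i : ℤ) (Y Y' : ModuleCat.{u} R) (e : Y ≃ₗ[R] LinearMap.ker (d i))
      (e' : Y' ≃ₗ[R] LinearMap.ker (d (i + 1))), GStep (op Y') (op Y) := by
    intro i Y Y' e e'
    obtain ⟨ι, p, hs, hι, hp⟩ := exact_sub (hd _) e e'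
    rw [gstep_op_iff]
    refine ⟨ModuleCat.of R (I i), ModuleCat.ofHom ι, ModuleCat.ofHom p, hs,
      (Module.injective_iff_injective_object _ _).1 (hI _), ?_⟩
    intro E hE' f
    have hE'' : Module.Injective R E := (Module.injective_iff_injective_object _ _).2 hE'
    let g : E →ₗ[R] I (i + 1) := (LinearMap.ker (d (i + 1))).subtype ∘ₗ e'.toLinearMap ∘ₗ f.hom
    have hg : d (i + 1) ∘ₗ g = 0 := by
      ext x
      exact (e' (f.hom x)).2
    obtain ⟨k, hk⟩ := (hE E _ _ hE'' i g).1 hg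
    refine ⟨ModuleCat.ofHom k, ?_⟩
    ext y
    change p (k y) = f.hom y
    apply e'.injective
    apply Subtype.ext
    rw [hp]
    exact LinearMap.congr_fun hk y
  refine ⟨fun Y => ∃ j, Nonempty (Y.unop ≃ₗ[R] LinearMap.ker (d j)), ⟨0, ⟨e⟩⟩, ?_⟩
  rintro Y ⟨j, ⟨e⟩⟩
  constructor
  · obtain ⟨i, rfl⟩ : ∃ i, j = i + 1 := ⟨j - 1, by ring⟩
    exact ⟨op (ModuleCat.of R (LinearMap.ker (d i))), ⟨i, ⟨LinearEquiv.refl R _⟩⟩,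
      key i _ _ (LinearEquiv.refl R _) e⟩
  · exact ⟨op (ModuleCat.of R (LinearMap.ker (d (j + 1)))), ⟨j + 1, ⟨LinearEquiv.refl R _⟩⟩,
      key j _ _ e (LinearEquiv.refl R _)⟩

lemma splice_exact {F P : ℤ → ModuleCat.{u} R} {ι : ∀ i, F i ⟶ P i} {p : ∀ i, P i ⟶ F (i + 1)}
    (h : ∀ i, Ses (ι i) (p i)) (i : ℤ) :
    Function.Exact ((ι (i + 1)).hom ∘ₗ (p i).hom) ((ι (i + 1 + 1)).hom ∘ₗ (p (i + 1)).hom) := by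
  intro x
  have h1 := ses_elim (h i)
  have h2 := ses_elim (h (i + 1))
  have h3 := ses_elim (h (i + 1 + 1))
  constructor
  · intro hx
    obtain ⟨y, rfl⟩ := (h2.2.1 x).1 (h3.1 (by rw [map_zero]; exact hx))
    obtain ⟨z, rfl⟩ := h1.2.2 y
    exact ⟨z, rfl⟩
  · rintro ⟨z, rfl⟩
    simp only [LinearMap.comp_apply]
    rw [h2.2.1.apply_apply_eq_zero, map_zero]

lemma splice_ker {F P : ℤ → ModuleCat.{u} R} {ι : ∀ i, F i ⟶ P i} {p : ∀ i, P i ⟶ F (i + 1)}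
    (h : ∀ i, Ses (ι i) (p i)) {M : Type u} [AddCommGroup M] [Module R M] (i : ℤ)
    (hF : F i = ModuleCat.of R M) :
    Nonempty (M ≃ₗ[R] LinearMap.ker ((ι (i + 1)).hom ∘ₗ (p i).hom)) := by
  have h1 := ses_elim (h i)
  have h2 := ses_elim (h (i + 1))
  have e : F i ≃ₗ[R] M := (eqToIso hF).toLinearEquiv
  refine ⟨e.symm.trans ((LinearEquiv.ofInjective (ι i).hom h1.1).trans (LinearEquiv.ofEq _ _ ?_))⟩
  rw [LinearMap.ker_comp_of_ker_eq_bot _ (LinearMap.ker_eq_bot.2 h2.1)]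
  exact h1.2.1.linearMap_ker_eq.symm

lemma concrete_of_gp {M : Type u} [AddCommGroup M] [Module R M] (h : GP (ModuleCat.of R M)) :
    GorensteinProjective R M := by
  obtain ⟨T, hM, hT⟩ := h
  obtain ⟨F, hF, hs⟩ := int_chain GStep T hT _ hM
  choose P ι p hs hP hf using hs
  refine ⟨fun i => P i, fun i => inferInstance, fun i => inferInstance,
    fun i => (ι (i + 1)).hom ∘ₗ (p i).hom, fun i => (IsProjective.iff_projective _).2 (hP i),
    splice_exact hs, splice_ker hs 0 hF, ?_⟩
  intro Q _ _ hQ i g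
  have h1 := ses_elim (hs i)
  have h2 := ses_elim (hs (i + 1))
  constructor
  · intro hg
    have hg' : g ∘ₗ (ι (i + 1)).hom = 0 := by
      ext y
      obtain ⟨z, rfl⟩ := h1.2.2 y
      exact LinearMap.congr_fun hg z
    obtain ⟨w, hs'⟩ := hs (i + 1)
    have := hs'.epi_g
    have hz : ι (i + 1) ≫ ModuleCat.ofHom g = 0 := by
      ext y; exact LinearMap.congr_fun hg' y
    obtain ⟨k, hk⟩ : ∃ k : F (i + 1 + 1) ⟶ ModuleCat.of R Q, p (i + 1) ≫ k = ModuleCat.ofHom g :=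
      ⟨hs'.exact.desc (ModuleCat.ofHom g) hz, hs'.exact.g_desc _ _⟩
    obtain ⟨k', hk'⟩ := hf (i + 1 + 1) (ModuleCat.of R Q) ((IsProjective.iff_projective _).1 hQ) k
    refine ⟨k'.hom, ?_⟩
    rw [← hk'] at hk
    exact congrArg ModuleCat.Hom.hom hk
  · rintro ⟨k, rfl⟩
    ext x
    change k (((ι (i + 1 + 1)).hom ∘ₗ (p (i + 1)).hom) (((ι (i + 1)).hom ∘ₗ (p i).hom) x)) = 0
    rw [(splice_exact hs i).apply_apply_eq_zero, map_zero]

lemma concrete_of_gi {M : Type u} [AddCommGroup M] [Module R M] (h : GP (op (ModuleCat.of R M))) :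
    GorensteinInjective R M := by
  obtain ⟨T, hM, hT⟩ := h
  obtain ⟨F, hF, hs⟩ := int_chain (fun A B : ModuleCat.{u} R => GStep (op B) (op A))
    (fun A => T (op A)) (fun x hx => by
      obtain ⟨⟨y, hy, hxy⟩, ⟨z, hz, hxz⟩⟩ := hT (op x) hx
      exact ⟨⟨z.unop, hz, hxz⟩, ⟨y.unop, hy, hxy⟩⟩) (ModuleCat.of R M) hM
  simp only [gstep_op_iff] at hs
  choose I ι p hs hI hf using hs
  refine ⟨fun i => I i, fun i => inferInstance, fun i => inferInstance,
    fun i => (ι (i + 1)).hom ∘ₗ (p i).hom,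
    fun i => (Module.injective_iff_injective_object _ _).2 (hI i),
    splice_exact hs, splice_ker hs 0 hF, ?_⟩
  intro E _ _ hE i g
  have h2 := ses_elim (hs (i + 1 + 1))
  constructor
  · intro hg
    obtain ⟨w, hs'⟩ := hs (i + 1)
    have := hs'.mono_f
    have hz : ModuleCat.ofHom g ≫ p (i + 1) = 0 := by
      ext y
      apply h2.1
      exact (LinearMap.congr_fun hg y).trans (map_zero _).symm
    obtain ⟨k, hk⟩ : ∃ k : ModuleCat.of R E ⟶ F (i + 1), k ≫ ι (i + 1) = ModuleCat.ofHom g :=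
      ⟨hs'.exact.lift (ModuleCat.ofHom g) hz, hs'.exact.lift_f _ _⟩
    obtain ⟨k', hk'⟩ := hf i (ModuleCat.of R E)
      ((Module.injective_iff_injective_object _ _).1 hE) k
    refine ⟨k'.hom, ?_⟩
    rw [← hk'] at hk
    exact congrArg ModuleCat.Hom.hom hk
  · rintro ⟨k, rfl⟩
    ext x
    exact (splice_exact hs i).apply_apply_eq_zero (k x)

lemma gorproj_congr {M N : Type u} [AddCommGroup M] [Module R M] [AddCommGroup N] [Module R N]
    (e : M ≃ₗ[R] N) (h : GorensteinProjective R N) : GorensteinProjective R M := by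
  obtain ⟨P, i1, i2, d, hP, hd, ⟨e'⟩, hQ⟩ := h
  exact ⟨P, i1, i2, d, hP, hd, ⟨e.trans e'⟩, hQ⟩

lemma gorinj_congr {M N : Type u} [AddCommGroup M] [Module R M] [AddCommGroup N] [Module R N]
    (e : M ≃ₗ[R] N) (h : GorensteinInjective R N) : GorensteinInjective R M := by
  obtain ⟨P, i1, i2, d, hP, hd, ⟨e'⟩, hQ⟩ := h
  exact ⟨P, i1, i2, d, hP, hd, ⟨e.trans e'⟩, hQ⟩

lemma gorproj_punit : GorensteinProjective R PUnit.{u + 1} := by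
  apply concrete_of_gp
  apply gp_of_projective
  exact (IsProjective.iff_projective _).1 inferInstance

lemma gorinj_punit : GorensteinInjective R PUnit.{u + 1} := by
  apply concrete_of_gi
  apply gp_of_projective
  apply Injective.injective_iff_projective_op.1
  apply Limits.IsZero.injective
  exact ModuleCat.isZero_of_subsingleton _

lemma lr_of_concrete (n : ℕ) (M : Type u) [AddCommGroup M] [Module R M]
    (h : HasLeftResolutionLE R (fun N _ _ => GorensteinProjective R N) M n) :
    LR n (ModuleCat.of R M) := by
  induction n generalizing M with
  | zero =>
    obtain ⟨G, _, _, d, π, hG, h0, hπ, hdπ, hd⟩ := h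
    have := h0 1 (by omega)
    have hinj : Function.Injective π := by
      rw [← LinearMap.ker_eq_bot, hdπ.linearMap_ker_eq, LinearMap.range_eq_bot]
      ext x
      rw [Subsingleton.elim (α := G 1) x 0]; simp
    exact gp_of_concrete (gorproj_congr (LinearEquiv.ofBijective π ⟨hinj, hπ⟩).symm (hG 0))
  | succ n ih =>
    obtain ⟨G, _, _, d, π, hG, h0, hπ, hdπ, hd⟩ := h
    refine ⟨ModuleCat.of R (LinearMap.ker π), ModuleCat.of R (G 0),
      ModuleCat.ofHom (LinearMap.ker π).subtype, ModuleCat.ofHom π,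
      ses_of _ _ (Subtype.val_injective) (LinearMap.exact_subtype_ker_map π) hπ,
      gp_of_concrete (hG 0), ih (LinearMap.ker π) ?_⟩
    refine ⟨fun i => G (i + 1), fun i => inferInstance, fun i => inferInstance,
      fun i => d (i + 1), (d 0).codRestrict (LinearMap.ker π) hdπ.apply_apply_eq_zero,
      fun i => hG (i + 1), fun i hi => h0 (i + 1) (by omega), ?_, ?_, fun i => hd (i + 1)⟩
    · rintro ⟨x, hx⟩
      obtain ⟨y, hy⟩ := (hdπ x).1 hx
      exact ⟨y, Subtype.ext hy⟩
    · intro x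
      rw [← hd 0 x, Subtype.ext_iff]
      rfl

/-- Prepend an object to a sequence of modules. -/
def consObj (A : ModuleCat.{u} R) (F : ℕ → ModuleCat.{u} R) : ℕ → ModuleCat.{u} R
  | 0 => A
  | i + 1 => F i

/-- Prepend a map to a chain of modules. -/
def consDown (A : ModuleCat.{u} R) (F : ℕ → ModuleCat.{u} R) (f : F 0 ⟶ A)
    (d : ∀ i, F (i + 1) ⟶ F i) : ∀ i, consObj A F (i + 1) ⟶ consObj A F i
  | 0 => f
  | i + 1 => d i

/-- Prepend a map to a cochain of modules. -/
def consUp (A : ModuleCat.{u} R) (F : ℕ → ModuleCat.{u} R) (f : A ⟶ F 0)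
    (d : ∀ i, F i ⟶ F (i + 1)) : ∀ i, consObj A F i ⟶ consObj A F (i + 1)
  | 0 => f
  | i + 1 => d i

lemma concrete_of_lr (n : ℕ) (M : Type u) [AddCommGroup M] [Module R M]
    (h : LR n (ModuleCat.of R M)) :
    HasLeftResolutionLE R (fun N _ _ => GorensteinProjective R N) M n := by
  induction n generalizing M with
  | zero =>
    refine ⟨fun i => consObj (ModuleCat.of R M) (fun _ => ModuleCat.of R PUnit) i, fun i => inferInstance, fun i => inferInstance, fun i => 0,
      (LinearMap.id : M →ₗ[R] M), ?_, ?_, ?s, ?_, ?_⟩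
    case s => exact Function.surjective_id
    · rintro (_ | i)
      · exact concrete_of_gp h
      · exact gorproj_punit
    · rintro (_ | i) hi
      · omega
      · exact inferInstanceAs (Subsingleton PUnit)
    · intro x
      constructor
      · intro hx; exact ⟨0, Eq.symm hx⟩
      · rintro ⟨y, rfl⟩; rfl
    · intro i x
      exact ⟨fun _ => ⟨0, Subsingleton.elim (α := PUnit) _ _⟩, fun _ => rfl⟩
  | succ n ih =>
    obtain ⟨K, G0, ι, p, hs, hG0, hK⟩ := h
    obtain ⟨h1, h2, h3⟩ := ses_elim hs
    obtain ⟨G, _, _, d, π, hG, h0, hπ, hdπ, hd⟩ := ih K hK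
    refine ⟨fun i => consObj G0 (fun i => ModuleCat.of R (G i)) i, fun i => inferInstance,
      fun i => inferInstance, fun i => (consDown G0 (fun i => ModuleCat.of R (G i))
        (ModuleCat.ofHom π ≫ ι) (fun i => ModuleCat.ofHom (d i)) i).hom, p.hom,
      ?_, ?_, h3, ?_, ?_⟩
    · rintro (_ | i)
      · exact concrete_of_gp hG0
      · exact hG i
    · rintro (_ | i) hi
      · omega
      · exact h0 i (by omega)
    · intro x
      refine Iff.trans (h2 x) ?_
      constructor
      · rintro ⟨y, rfl⟩
        obtain ⟨z, rfl⟩ := hπ y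
        exact ⟨z, rfl⟩
      · rintro ⟨z, rfl⟩
        exact ⟨π z, rfl⟩
    · rintro (_ | i)
      · intro x
        refine Iff.trans ?_ (hdπ x)
        exact ⟨fun hx => h1 (Eq.trans hx (map_zero _).symm), fun hx => 
          (congrArg ι.hom hx).trans (map_zero _)⟩
      · exact hd i

lemma rr_of_concrete (n : ℕ) (M : Type u) [AddCommGroup M] [Module R M]
    (h : HasRightResolutionLE R (fun N _ _ => GorensteinInjective R N) M n) :
    LR n (op (ModuleCat.of R M)) := by
  induction n generalizing M with
  | zero =>
    obtain ⟨G, _, _, d, ι, hG, h0, hι, hdι, hd⟩ := h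
    have := h0 1 (by omega)
    have hsurj : Function.Surjective ι := fun x => (hdι x).1 (Subsingleton.elim (α := G 1) _ _)
    exact gi_of_concrete (gorinj_congr (LinearEquiv.ofBijective ι ⟨hι, hsurj⟩) (hG 0))
  | succ n ih =>
    obtain ⟨G, _, _, d, ι, hG, h0, hι, hdι, hd⟩ := h
    refine ⟨op (ModuleCat.of R (G 0 ⧸ LinearMap.range ι)), op (ModuleCat.of R (G 0)),
      (ModuleCat.ofHom (LinearMap.range ι).mkQ).op, (ModuleCat.ofHom ι).op,
      (ses_of _ _ hι (LinearMap.exact_map_mkQ_range ι) (Submodule.mkQ_surjective _)).op,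
      gi_of_concrete (hG 0), ih (G 0 ⧸ LinearMap.range ι) ?_⟩
    refine ⟨fun i => G (i + 1), fun i => inferInstance, fun i => inferInstance,
      fun i => d (i + 1), (LinearMap.range ι).liftQ (d 0) hdι.linearMap_ker_eq.ge,
      fun i => hG (i + 1), fun i hi => h0 (i + 1) (by omega), ?_, ?_, fun i => hd (i + 1)⟩
    · rw [← LinearMap.ker_eq_bot]
      exact Submodule.ker_liftQ_eq_bot _ _ _ hdι.linearMap_ker_eq.le
    · intro x
      rw [hd 0 x]
      constructor
      · rintro ⟨y, rfl⟩
        exact ⟨Submodule.Quotient.mk y, rfl⟩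
      · rintro ⟨y, rfl⟩
        obtain ⟨y, rfl⟩ := Submodule.mkQ_surjective _ y
        exact ⟨y, rfl⟩

lemma concrete_of_rr (n : ℕ) (M : Type u) [AddCommGroup M] [Module R M]
    (h : LR n (op (ModuleCat.of R M))) :
    HasRightResolutionLE R (fun N _ _ => GorensteinInjective R N) M n := by
  induction n generalizing M with
  | zero =>
    refine ⟨fun i => consObj (ModuleCat.of R M) (fun _ => ModuleCat.of R PUnit) i, fun i => inferInstance, fun i => inferInstance, fun i => 0,
      (LinearMap.id : M →ₗ[R] M), ?_, ?_, ?s, ?_, ?_⟩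
    case s => exact Function.injective_id
    · rintro (_ | i)
      · exact concrete_of_gi h
      · exact gorinj_punit
    · rintro (_ | i) hi
      · omega
      · exact inferInstanceAs (Subsingleton PUnit)
    · intro x
      exact ⟨fun _ => ⟨x, rfl⟩, fun _ => rfl⟩
    · intro i x
      exact ⟨fun _ => ⟨0, Subsingleton.elim (α := PUnit) _ _⟩, fun _ => rfl⟩
  | succ n ih =>
    obtain ⟨K, G0, p, ι, hs, hG0, hK⟩ := h
    obtain ⟨h1, h2, h3⟩ := ses_elim hs.unop
    obtain ⟨G, _, _, d, j, hG, h0, hj, hdj, hd⟩ := ih K.unop hK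
    refine ⟨fun i => consObj G0.unop (fun i => ModuleCat.of R (G i)) i, fun i => inferInstance,
      fun i => inferInstance, fun i => (consUp G0.unop (fun i => ModuleCat.of R (G i))
        (p.unop ≫ ModuleCat.ofHom j) (fun i => ModuleCat.ofHom (d i)) i).hom, ι.unop.hom,
      ?_, ?_, h1, ?_, ?_⟩
    · rintro (_ | i)
      · exact concrete_of_gi hG0
      · exact hG i
    · rintro (_ | i) hi
      · omega
      · exact h0 i (by omega)
    · intro x
      refine Iff.trans ?_ (h2 x)
      exact ⟨fun hx => hj (Eq.trans hx (map_zero _).symm), fun hx => 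
          (congrArg j hx).trans (map_zero _)⟩
    · rintro (_ | i)
      · intro x
        refine (hdj x).trans ?_
        constructor
        · rintro ⟨y, rfl⟩
          obtain ⟨z, rfl⟩ := h3 y
          exact ⟨z, rfl⟩
        · rintro ⟨z, rfl⟩
          exact ⟨p.unop.hom z, rfl⟩
      · exact hd i

lemma sInf_coe_le (S : Set ℕ) (hS : ∀ m n, m ≤ n → m ∈ S → n ∈ S) (n : ℕ) :
    sInf ((↑) '' S : Set ℕ∞) ≤ n ↔ n ∈ S := by
  constructor
  · intro h
    have hne : ((↑) '' S : Set ℕ∞).Nonempty := by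
      by_contra hne
      rw [Set.not_nonempty_iff_eq_empty] at hne
      rw [hne, sInf_empty] at h
      exact absurd h (by simp)
    obtain ⟨m, hm, hmn⟩ := csInf_mem hne
    rw [← hmn] at h
    exact hS m n (by exact_mod_cast h) hm
  · intro h
    exact sInf_le ⟨n, h, rfl⟩

lemma gpgldim_le (n : ℕ) : GPgldim R ≤ n ↔ ∀ M : ModuleCat.{u} R, LR n M := by
  have hm : ∀ (M : Type u) [AddCommGroup M] [Module R M], gpDim R M ≤ n ↔
      LR n (ModuleCat.of R M) := by
    intro M _ _
    refine (sInf_coe_le _ ?_ n).trans ⟨lr_of_concrete n M, concrete_of_lr n M⟩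
    rintro a b hab ⟨G, i1, i2, d, π, hG, h0, h⟩
    exact ⟨G, i1, i2, d, π, hG, fun i hi => h0 i (by omega), h⟩
  constructor
  · intro h M
    refine (hm M).1 (le_trans (le_sSup ?_) h)
    exact ⟨M, inferInstance, inferInstance, rfl⟩
  · intro h
    apply sSup_le
    rintro _ ⟨M, _, _, rfl⟩
    exact (hm M).2 (h _)

lemma gigldim_le (n : ℕ) : GIgldim R ≤ n ↔ ∀ M : ModuleCat.{u} R, LR n (op M) := by
  have hm : ∀ (M : Type u) [AddCommGroup M] [Module R M], giDim R M ≤ n ↔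
      LR n (op (ModuleCat.of R M)) := by
    intro M _ _
    refine (sInf_coe_le _ ?_ n).trans ⟨rr_of_concrete n M, concrete_of_rr n M⟩
    rintro a b hab ⟨G, i1, i2, d, π, hG, h0, h⟩
    exact ⟨G, i1, i2, d, π, hG, fun i hi => h0 i (by omega), h⟩
  constructor
  · intro h M
    refine (hm M).1 (le_trans (le_sSup ?_) h)
    exact ⟨M, inferInstance, inferInstance, rfl⟩
  · intro h
    apply sSup_le
    rintro _ ⟨M, _, _, rfl⟩
    exact (hm M).2 (h _)

lemma enat_le_of {a b : ℕ∞} (h : ∀ n : ℕ, b ≤ n → a ≤ n) : a ≤ b := by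
  cases b with
  | top => exact le_top
  | coe b => exact h b le_rfl

end Concrete

end GorAux

/-- `sup { Gpd_R(M) | M an R-module } = sup { Gid_R(M) | M an R-module }`. -/
theorem GPgldim_eq_GIgldim (R : Type u) [Ring R] :
    GPgldim R = GIgldim R := by
  have key : ∀ n : ℕ, GPgldim R ≤ n ↔ GIgldim R ≤ n := fun n =>
    (GorAux.gpgldim_le n).trans ((GorAux.main_op n).trans (GorAux.gigldim_le n).symm)
  exact le_antisymm (GorAux.enat_le_of fun n => (key n).2) (GorAux.enat_le_of fun n => (key n).1)
end
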